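/- arXiv:1703.05178 — 7 statements merged into one kernel-verified Lean document; each statement's English description precedes it below -/
import Mathlib

section
/- Let f be a non-constant Herglotz function, let ω₀ ∈ ℝ, and suppose f extends to a function analytic on ℂ⁺ ∪ U for some open neighbourhood U of ω₀ in ℂ. If f(ω₀) = 0, then this zero is simple and the derivative f′(ω₀) is a positive real number. -/
open Complex

/-- A Herglotz function: a function analytic on the open upper half-plane
`ℂ⁺ = {ω : ℂ | 0 < ω.im}` whose imaginary part is nonnegative there. -/
def IsHerglotz (f : ℂ → ℂ) : Prop :=
  DifferentiableOn ℂ f {z : ℂ | 0 < z.im} ∧ ∀ z : ℂ, 0 < z.im → 0 ≤ (f z).im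

theorem herglotz_aux_pow (a : ℂ) (ha : a ≠ 0) (n : ℕ) (hn : 1 ≤ n)
    (h : ∀ u : ℂ, 0 < u.im → 0 ≤ (u ^ n * a).im) : n = 1 ∧ a.im = 0 ∧ 0 < a.re := by
  have h' : ∀ u : ℂ, 0 ≤ u.im → 0 ≤ (u ^ n * a).im := by
    have hc : IsClosed {u : ℂ | 0 ≤ (u ^ n * a).im} :=
      isClosed_le continuous_const (by fun_prop)
    have hs : closure {u : ℂ | 0 < u.im} ⊆ {u : ℂ | 0 ≤ (u ^ n * a).im} :=
      closure_minimal (fun u hu => h u hu) hc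
    rw [Complex.closure_setOfPred_lt_im] at hs
    exact fun u hu => hs hu
  have hn1 : n = 1 := by
    by_contra hne
    have hn2 : 2 ≤ n := by omega
    have hn2' : (2 : ℝ) ≤ n := by exact_mod_cast hn2
    have hn0 : (n : ℂ) ≠ 0 := by exact_mod_cast (by omega : n ≠ 0)
    set w : ℂ := -I / a with hw
    have hw0 : w ≠ 0 := by simp [hw, ha]
    obtain ⟨φ, h0, h2, hφ⟩ : ∃ φ : ℝ, 0 ≤ φ ∧ φ ≤ 2 * Real.pi ∧
        (‖w‖ : ℂ) * exp (φ * I) = w := by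
      have hp := Real.pi_pos
      rcases le_or_gt 0 (arg w) with hh | hh
      · exact ⟨arg w, hh, by linarith [arg_le_pi w], norm_mul_exp_arg_mul_I w⟩
      · refine ⟨arg w + 2 * Real.pi, by linarith [neg_pi_lt_arg w], by linarith, ?_⟩
        have : ((arg w + 2 * Real.pi : ℝ) : ℂ) * I = arg w * I + 2 * Real.pi * I := by
          push_cast; ring
        rw [this, exp_add, exp_two_pi_mul_I, mul_one]
        exact norm_mul_exp_arg_mul_I w
    have hpos : 0 < ‖w‖ := norm_pos_iff.2 hw0
    have hu := h' (exp ((φ / n : ℝ) * I)) (by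
      rw [exp_ofReal_mul_I_im]
      apply Real.sin_nonneg_of_nonneg_of_le_pi (by positivity)
      rw [div_le_iff₀ (by linarith)]
      nlinarith [Real.pi_pos])
    rw [← exp_nat_mul] at hu
    have e : (n : ℂ) * ((φ / n : ℝ) * I) = φ * I := by
      push_cast; field_simp
    rw [e] at hu
    have e2 : (‖w‖ : ℂ) * (exp (φ * I) * a) = -I := by
      rw [← mul_assoc, hφ, hw]; field_simp
    have e3 := congrArg Complex.im e2
    rw [Complex.im_ofReal_mul] at e3
    simp only [neg_im, I_im] at e3
    nlinarith
  subst hn1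
  have h1 := h' 1 (by simp)
  have h2 := h' (-1) (by simp)
  have h3 := h' I (by simp)
  simp at h1 h2 h3
  have him : a.im = 0 := le_antisymm h2 h1
  refine ⟨rfl, him, lt_of_le_of_ne h3 fun hre => ha (Complex.ext hre.symm him)⟩

/-- If a non-constant Herglotz function extends analytically to a neighbourhood of a real
point `ω₀` at which the extension vanishes, then the zero is simple and the derivative at
`ω₀` is a positive real number. -/
theorem real_zero_of_herglotz_simple (f F : ℂ → ℂ) (hf : IsHerglotz f)
    (hnc : ∃ z₁ z₂ : ℂ, 0 < z₁.im ∧ 0 < z₂.im ∧ f z₁ ≠ f z₂)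
    (ω₀ : ℝ) (U : Set ℂ) (hU : IsOpen U) (hω₀U : (ω₀ : ℂ) ∈ U)
    (hF : DifferentiableOn ℂ F ({z : ℂ | 0 < z.im} ∪ U))
    (hext : ∀ z : ℂ, 0 < z.im → F z = f z)
    (hzero : F (ω₀ : ℂ) = 0) :
    (deriv F (ω₀ : ℂ)).im = 0 ∧ 0 < (deriv F (ω₀ : ℂ)).re := by
  have hV : IsOpen ({z : ℂ | 0 < z.im} ∪ U) :=
    (isOpen_lt continuous_const Complex.continuous_im).union hU
  have hFan : ∀ z ∈ ({z : ℂ | 0 < z.im} ∪ U), AnalyticAt ℂ F z :=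
    fun z hz => hF.analyticAt (hV.mem_nhds hz)
  have hA := hFan ω₀ (Or.inr hω₀U)
  have hlim : ∀ u : ℂ, Filter.Tendsto (fun r : ℝ => (ω₀ : ℂ) + r * u)
      (nhdsWithin 0 (Set.Ioi 0)) (nhds (ω₀ : ℂ)) := by
    intro u
    have : Continuous (fun r : ℝ => (ω₀ : ℂ) + r * u) := by fun_prop
    have h := this.tendsto 0
    simp only [ofReal_zero, zero_mul, add_zero] at h
    exact h.mono_left nhdsWithin_le_nhds
  have hrpos : ∀ᶠ r : ℝ in nhdsWithin 0 (Set.Ioi 0), 0 < r := self_mem_nhdsWithin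
  have hnz : ¬ ∀ᶠ z in nhds (ω₀ : ℂ), F z = 0 := by
    intro hz
    obtain ⟨r, hr, hr0⟩ := (((hlim I).eventually hz.eventually_nhds).and hrpos).exists
    have hpre : IsPreconnected {z : ℂ | 0 < z.im} :=
      (convex_halfSpace_im_gt 0).isPreconnected
    have hon : AnalyticOnNhd ℂ F {z : ℂ | 0 < z.im} := fun z hz => hFan z (Or.inl hz)
    have heq := hon.eqOn_zero_of_preconnected_of_eventuallyEq_zero hpre
      (z₀ := (ω₀ : ℂ) + r * I) (by simpa using hr0) hr
    obtain ⟨z₁, z₂, h1, h2, hne⟩ := hnc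
    apply hne
    rw [← hext z₁ h1, ← hext z₂ h2, heq h1, heq h2]; rfl
  obtain ⟨n, g, hg, hg0, hFg⟩ := hA.exists_eventuallyEq_pow_smul_nonzero_iff.2 hnz
  have hn : 1 ≤ n := by
    by_contra hlt
    have h0 : n = 0 := by omega
    subst h0
    have := hFg.self_of_nhds
    simp [hzero] at this
    exact hg0 this.symm
  have key : ∀ u : ℂ, 0 < u.im → 0 ≤ (u ^ n * g ω₀).im := by
    intro u hu
    have ht : Filter.Tendsto (fun r : ℝ => (u ^ n * g ((ω₀ : ℂ) + r * u)).im)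
        (nhdsWithin 0 (Set.Ioi 0)) (nhds (u ^ n * g ω₀).im) :=
      (Complex.continuous_im.tendsto _).comp
        ((hg.continuousAt.tendsto.comp (hlim u)).const_mul (u ^ n))
    refine ge_of_tendsto ht ?_
    filter_upwards [hrpos, (hlim u).eventually hFg] with r hr hz
    have him : 0 < ((ω₀ : ℂ) + r * u).im := by
      simpa using mul_pos hr hu
    have h1 := hf.2 _ him
    rw [← hext _ him, hz] at h1
    have e : ((ω₀ : ℂ) + r * u - ω₀) ^ n • g ((ω₀ : ℂ) + r * u)
        = ((r ^ n : ℝ) : ℂ) * (u ^ n * g ((ω₀ : ℂ) + r * u)) := by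
      rw [smul_eq_mul]; push_cast; ring
    rw [e, Complex.im_ofReal_mul] at h1
    exact nonneg_of_mul_nonneg_right h1 (pow_pos hr n)
  obtain ⟨h1, him, hre⟩ := herglotz_aux_pow _ hg0 n hn key
  subst h1
  have hd : deriv F (ω₀ : ℂ) = g ω₀ := by
    have hFg' : F =ᶠ[nhds (ω₀ : ℂ)] fun z => (z - ω₀) * g z := by
      filter_upwards [hFg] with z hz
      simpa using hz
    rw [hFg'.deriv_eq]
    have := ((hasDerivAt_id (ω₀ : ℂ)).sub_const (ω₀ : ℂ)).mul hg.differentiableAt.hasDerivAt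
    have h2 := this.deriv
    simp only [id, sub_self, zero_mul, add_zero, one_mul] at h2
    exact h2
  rw [hd]
  exact ⟨him, hre⟩
end

section
/- Let f be a non-constant Herglotz function, let ω₀ ∈ ℝ, and suppose f extends to a function analytic on (ℂ⁺ ∪ U) \ {ω₀} for some open neighbourhood U of ω₀ in ℂ, having a pole at ω₀. Then the pole is simple and the residue of f at ω₀, i.e. the limit of (ω − ω₀) f(ω) as ω → ω₀, is a negative real number. -/
open Complex Filter

lemma key_angle (n : ℕ) (hn : n ≠ 0) (a : ℂ) (ha : a ≠ 0)
    (h : ∀ θ : ℝ, 0 < θ → θ < Real.pi → (exp (θ * I) ^ n * a).im ≤ 0) :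
    n = 1 ∧ a.im = 0 ∧ a.re < 0 := by
  have hn' : (0 : ℝ) < n := by positivity
  have hnc : (n : ℂ) ≠ 0 := by exact_mod_cast hn
  have hcl : ∀ θ : ℝ, θ ∈ Set.Icc 0 Real.pi → (exp (θ * I) ^ n * a).im ≤ 0 := by
    have hc : IsClosed {θ : ℝ | (exp (θ * I) ^ n * a).im ≤ 0} := by
      apply isClosed_le
      · fun_prop
      · fun_prop
    have hs : Set.Ioo 0 Real.pi ⊆ {θ : ℝ | (exp (θ * I) ^ n * a).im ≤ 0} :=
      fun θ hθ => h θ hθ.1 hθ.2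
    have := closure_minimal hs hc
    rw [closure_Ioo Real.pi_pos.ne] at this
    exact this
  have hpi := Real.pi_pos
  have h1n : (1 : ℝ) ≤ n := by exact_mod_cast Nat.one_le_iff_ne_zero.mpr hn
  have e0 : a.im ≤ 0 := by
    have h0 := hcl 0 ⟨le_rfl, hpi.le⟩
    simpa using h0
  have e1 : 0 ≤ a.im := by
    have := hcl (Real.pi / n) ⟨by positivity, div_le_self hpi.le h1n⟩
    rw [← exp_nat_mul, show (n : ℂ) * (((Real.pi / n : ℝ) : ℂ) * I) = Real.pi * I by
      push_cast; field_simp, exp_pi_mul_I] at this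
    simpa using this
  have him : a.im = 0 := le_antisymm e0 e1
  have hre : a.re ≤ 0 := by
    have := hcl (Real.pi / 2 / n) ⟨by positivity, (div_le_self (by positivity) h1n).trans (by linarith)⟩
    rw [← exp_nat_mul, show (n : ℂ) * (((Real.pi / 2 / n : ℝ) : ℂ) * I) = Real.pi / 2 * I by
      push_cast; field_simp, exp_pi_div_two_mul_I] at this
    simpa using this
  have hre' : a.re < 0 := lt_of_le_of_ne hre fun h0 => ha (Complex.ext h0 him)
  refine ⟨?_, him, hre'⟩
  by_contra hne
  have h2n : (2 : ℝ) ≤ n := by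
    have : 2 ≤ n := by omega
    exact_mod_cast this
  have := hcl (Real.pi * 3 / 2 / n) ⟨by positivity, by
    rw [div_le_iff₀ hn']; nlinarith⟩
  rw [← exp_nat_mul, show (n : ℂ) * (((Real.pi * 3 / 2 / n : ℝ) : ℂ) * I)
      = Real.pi * I + Real.pi / 2 * I by push_cast; field_simp; ring,
      exp_add, exp_pi_mul_I, exp_pi_div_two_mul_I] at this
  simp at this
  linarith

/-- If a non-constant Herglotz function extends analytically to a punctured neighbourhood of a
real point `ω₀`, with a pole at `ω₀`, then the pole is simple and the residue of the extension
at `ω₀`, i.e. the limit of `(ω - ω₀) F ω` as `ω → ω₀`, is a negative real number. -/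
theorem real_pole_of_herglotz_simple_residue_neg (f F : ℂ → ℂ) (hf : IsHerglotz f)
    (hnc : ∃ z₁ z₂ : ℂ, 0 < z₁.im ∧ 0 < z₂.im ∧ f z₁ ≠ f z₂)
    (ω₀ : ℝ) (U : Set ℂ) (hU : IsOpen U) (hω₀U : (ω₀ : ℂ) ∈ U)
    (hF : DifferentiableOn ℂ F (({z : ℂ | 0 < z.im} ∪ U) \ {(ω₀ : ℂ)}))
    (hext : ∀ z : ℂ, 0 < z.im → F z = f z)
    (hpole : Tendsto (fun z : ℂ => ‖F z‖) (nhdsWithin (ω₀ : ℂ) {(ω₀ : ℂ)}ᶜ) atTop) :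
    ∃ c : ℝ, c < 0 ∧
      Tendsto (fun z : ℂ => (z - (ω₀ : ℂ)) * F z)
        (nhdsWithin (ω₀ : ℂ) {(ω₀ : ℂ)}ᶜ) (nhds (c : ℂ)) := by
  classical
  have hFim : ∀ z : ℂ, 0 < z.im → 0 ≤ (F z).im := fun z hz => by
    rw [hext z hz]; exact hf.2 z hz
  set w : ℂ := (ω₀ : ℂ) with hw
  set g : ℂ → ℂ := Function.update (fun z => (F z)⁻¹) w 0 with hg
  have hgne : ∀ z, z ≠ w → g z = (F z)⁻¹ := fun z hz => by simp [hg, hz]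
  have hgw : g w = 0 := by simp [hg]
  have hFne : ∀ᶠ z in nhdsWithin w {w}ᶜ, F z ≠ 0 := by
    filter_upwards [hpole.eventually_gt_atTop 0] with z hz
    exact norm_pos_iff.mp hz
  have hUe : ∀ᶠ z in nhdsWithin w {w}ᶜ, z ∈ U :=
    nhdsWithin_le_nhds (hU.mem_nhds hω₀U)
  have hcont : ContinuousAt g w := by
    rw [hg, continuousAt_update_same]
    rw [tendsto_zero_iff_norm_tendsto_zero]
    simpa [Function.comp_def] using tendsto_inv_atTop_zero.comp hpole
  have han : AnalyticAt ℂ g w := by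
    apply analyticAt_of_differentiable_on_punctured_nhds_of_continuousAt _ hcont
    filter_upwards [hFne, hUe, self_mem_nhdsWithin] with z h1 h2 h3
    have hz : z ≠ w := h3
    have hFd : DifferentiableAt ℂ F z := by
      have hd : DifferentiableOn ℂ F (U \ {w}) :=
        hF.mono (Set.sdiff_subset_sdiff_left Set.subset_union_right)
      exact hd.differentiableAt ((hU.sdiff isClosed_singleton).mem_nhds ⟨h2, h3⟩)
    refine (hFd.inv h1).congr_of_eventuallyEq ?_
    filter_upwards [isOpen_ne.mem_nhds hz] with y hy
    exact hgne y hy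
  have hord : ¬ ∀ᶠ z in nhds w, g z = 0 := by
    intro h
    have h' : ∀ᶠ z in nhdsWithin w {w}ᶜ, g z = 0 := nhdsWithin_le_nhds h
    obtain ⟨z, h1, h2, h3⟩ := (h'.and (hFne.and self_mem_nhdsWithin)).exists
    rw [hgne z h3] at h1
    exact h2 (inv_eq_zero.mp h1)
  obtain ⟨n, h, hhan, hh0, hgh⟩ := han.exists_eventuallyEq_pow_smul_nonzero_iff.mpr hord
  have hn : n ≠ 0 := by
    rintro rfl
    have := hgh.self_of_nhds
    rw [hgw] at this
    simp at this
    exact hh0 this.symm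
  have hang : ∀ θ : ℝ, 0 < θ → θ < Real.pi → (exp (θ * I) ^ n * h w).im ≤ 0 := by
    intro θ h0 h1
    have hp : Tendsto (fun r : ℝ => w + r * exp (θ * I)) (nhdsWithin 0 (Set.Ioi 0)) (nhds w) := by
      have : Continuous (fun r : ℝ => w + r * exp (θ * I)) := by fun_prop
      have := this.tendsto 0
      simp only [ofReal_zero, zero_mul, add_zero] at this
      exact this.mono_left nhdsWithin_le_nhds
    have hl : Tendsto (fun r : ℝ => (exp (θ * I) ^ n * h (w + r * exp (θ * I))).im)
        (nhdsWithin 0 (Set.Ioi 0)) (nhds (exp (θ * I) ^ n * h w).im) :=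
      (continuous_im.tendsto _).comp
        ((hhan.continuousAt.tendsto.comp hp).const_mul _)
    refine le_of_tendsto hl ?_
    filter_upwards [hp.eventually hgh, self_mem_nhdsWithin] with r hr hr0
    have hr0 : 0 < r := hr0
    have him : 0 < (w + r * exp (θ * I)).im := by
      have := Real.sin_pos_of_pos_of_lt_pi h0 h1
      simp [hw, exp_ofReal_mul_I_im]
      positivity
    have hne : w + r * exp (θ * I) ≠ w := by
      intro h; rw [h] at him; simp [hw] at him
    rw [hgne _ hne] at hr
    have h3 : ((F (w + r * exp (θ * I)))⁻¹).im ≤ 0 := by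
      rw [inv_im]
      exact div_nonpos_of_nonpos_of_nonneg (neg_nonpos.mpr (hFim _ him)) (normSq_nonneg _)
    rw [hr, add_sub_cancel_left, smul_eq_mul, mul_pow, mul_assoc, ← ofReal_pow, im_ofReal_mul] at h3
    exact nonpos_of_mul_nonpos_right h3 (by positivity)
  obtain ⟨hn1, haim, hare⟩ := key_angle n hn (h w) hh0 hang
  subst hn1
  have haeq : h w = ((h w).re : ℂ) := Complex.ext (by simp) (by simp [haim])
  refine ⟨((h w).re)⁻¹, inv_neg''.mpr hare, ?_⟩
  rw [ofReal_inv, ← haeq]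
  have hl : Tendsto (fun z => (h z)⁻¹) (nhdsWithin w {w}ᶜ) (nhds (h w)⁻¹) :=
    (hhan.continuousAt.tendsto.inv₀ hh0).mono_left nhdsWithin_le_nhds
  refine hl.congr' ?_
  filter_upwards [nhdsWithin_le_nhds hgh, self_mem_nhdsWithin] with z hz hzw
  have hzw : z ≠ w := hzw
  have hz : g z = (z - w) ^ 1 • h z := hz
  rw [hgne z hzw, pow_one, smul_eq_mul] at hz
  rw [← inv_inv (F z), hz, mul_inv, mul_inv_cancel_left₀ (sub_ne_zero.mpr hzw)]
end

section
/- Let ε and μ be rational functions with complex coefficients that are real-valued at every real point that is not a pole (lossless), satisfy the reality principle ε(−conj(ω)) = conj(ε(ω)) and μ(−conj(ω)) = conj(μ(ω)), and are such that ω ↦ ω ε(ω) and ω ↦ ω μ(ω) are Herglotz functions on ℂ⁺ (passivity). Then the medium is non-dissipative: for every real r > 0, every complex solution ω of ω² ε(ω) μ(ω) = r is real. -/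
open Polynomial Complex

lemma herglotz_aux (f : ℂ → ℂ) (hf : IsHerglotz f) (w : ℂ) (hw : 0 < w.im)
    (h0 : (f w).im = 0) : f I = f w := by
  have hU : IsOpen {z : ℂ | 0 < z.im} := isOpen_lt continuous_const Complex.continuous_im
  have hA : AnalyticOnNhd ℂ f {z : ℂ | 0 < z.im} := hf.1.analyticOnNhd hU
  have hc : IsPreconnected {z : ℂ | 0 < z.im} := (convex_halfSpace_im_gt 0).isPreconnected
  rcases hA.is_constant_or_isOpen hc with ⟨c, h⟩ | h
  · rw [h I (by simp), h w hw]
  · exfalso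
    have ho := h _ subset_rfl hU
    rw [Metric.isOpen_iff] at ho
    obtain ⟨δ, hδ, hb⟩ := ho (f w) ⟨w, hw, rfl⟩
    have hm : f w - ((δ / 2 : ℝ) : ℂ) * I ∈ Metric.ball (f w) δ := by
      rw [Metric.mem_ball, dist_eq_norm]
      simp
      rw [abs_of_pos hδ]
      linarith
    obtain ⟨z, hz, hze⟩ := hb hm
    have h1 := hf.2 z hz
    rw [hze] at h1
    rw [Complex.sub_im, Complex.im_ofReal_mul, h0] at h1
    simp at h1
    linarith

lemma eval_real_aux (p : RatFunc ℂ)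
    (hp : ∀ z : ℂ, Polynomial.eval z p.denom ≠ 0 →
      RatFunc.eval (RingHom.id ℂ) (-(starRingEnd ℂ z)) p
        = starRingEnd ℂ (RatFunc.eval (RingHom.id ℂ) z p))
    (h0 : (I * RatFunc.eval (RingHom.id ℂ) I p).im = 0) :
    I * RatFunc.eval (RingHom.id ℂ) I p = 0 := by
  by_cases hd : Polynomial.eval I p.denom = 0
  · have : RatFunc.eval (RingHom.id ℂ) I p = 0 := by
      simp [RatFunc.eval, Polynomial.eval₂_id, hd]
    rw [this, mul_zero]
  · have h := hp I hd
    rw [Complex.conj_I, neg_neg] at h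
    have h2 := Complex.conj_eq_iff_im.1 h.symm
    apply Complex.ext
    · simp [h2]
    · simpa using h0

lemma conj_eval (q : ℂ[X]) (z : ℂ) :
    (q.map (starRingEnd ℂ)).eval z = starRingEnd ℂ (q.eval (starRingEnd ℂ z)) := by
  rw [← Polynomial.eval_map_apply]
  simp

lemma loss_aux (p : RatFunc ℂ)
    (hp : ∀ x : ℝ, Polynomial.eval (x : ℂ) p.denom ≠ 0 →
      (RatFunc.eval (RingHom.id ℂ) (x : ℂ) p).im = 0)
    (w : ℂ) (hw : Polynomial.eval w p.denom ≠ 0) :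
    Polynomial.eval (starRingEnd ℂ w) p.denom ≠ 0 ∧
    RatFunc.eval (RingHom.id ℂ) (starRingEnd ℂ w) p
      = starRingEnd ℂ (RatFunc.eval (RingHom.id ℂ) w p) := by
  have key : p.num * p.denom.map (starRingEnd ℂ) = p.num.map (starRingEnd ℂ) * p.denom := by
    apply Polynomial.eq_of_infinite_eval_eq
    apply (Set.infinite_range_of_injective Complex.ofReal_injective).mono
    rintro _ ⟨x, rfl⟩
    simp only [Set.mem_setOf_eq, Polynomial.eval_mul, conj_eval, Complex.conj_ofReal]
    by_cases hx : Polynomial.eval (x : ℂ) p.denom = 0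
    · simp [hx]
    · have h := Complex.conj_eq_iff_im.2 (hp x hx)
      have hx' : starRingEnd ℂ (Polynomial.eval (x : ℂ) p.denom) ≠ 0 := by simpa using hx
      simp only [RatFunc.eval, Polynomial.eval₂_id, map_div₀] at h
      rw [div_eq_div_iff hx' hx] at h
      exact h.symm
  have k := congrArg (Polynomial.eval w) key
  simp only [Polynomial.eval_mul, conj_eval] at k
  have hd : Polynomial.eval (starRingEnd ℂ w) p.denom ≠ 0 := by
    intro h
    rw [h, map_zero, mul_zero] at k
    have hn : Polynomial.eval (starRingEnd ℂ w) p.num = 0 := by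
      rcases mul_eq_zero.1 k.symm with h' | h'
      · simpa using h'
      · exact absurd h' hw
    obtain ⟨a, b, hab⟩ := p.isCoprime_num_denom
    have := congrArg (Polynomial.eval (starRingEnd ℂ w)) hab
    simp [hn, h] at this
  refine ⟨hd, ?_⟩
  have k2 := congrArg (starRingEnd ℂ) k
  simp only [map_mul, Complex.conj_conj] at k2
  have hw' : starRingEnd ℂ (Polynomial.eval w p.denom) ≠ 0 := by simpa using hw
  simp only [RatFunc.eval, Polynomial.eval₂_id, map_div₀]
  rw [div_eq_div_iff hd hw']
  exact k2.symm

lemma upper_aux (ε μ : RatFunc ℂ)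
    (hεreal : ∀ z : ℂ, Polynomial.eval z ε.denom ≠ 0 →
      RatFunc.eval (RingHom.id ℂ) (-(starRingEnd ℂ z)) ε
        = starRingEnd ℂ (RatFunc.eval (RingHom.id ℂ) z ε))
    (hεH : IsHerglotz (fun z : ℂ => z * RatFunc.eval (RingHom.id ℂ) z ε))
    (hμH : IsHerglotz (fun z : ℂ => z * RatFunc.eval (RingHom.id ℂ) z μ))
    (r : ℝ) (hr : 0 < r) (w : ℂ) (hw : 0 < w.im)
    (h : w ^ 2 * RatFunc.eval (RingHom.id ℂ) w ε * RatFunc.eval (RingHom.id ℂ) w μ = (r : ℂ)) :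
    False := by
  have h1 := hεH.2 w hw
  have h2 := hμH.2 w hw
  have h3 := herglotz_aux _ hεH w hw
  have h4 := eval_real_aux ε hεreal
  simp only at h1 h2 h3
  have h' : (w * RatFunc.eval (RingHom.id ℂ) w ε) * (w * RatFunc.eval (RingHom.id ℂ) w μ)
      = (r : ℂ) := by rw [← h]; ring
  generalize w * RatFunc.eval (RingHom.id ℂ) w ε = a at *
  generalize w * RatFunc.eval (RingHom.id ℂ) w μ = b at *
  have hre := congrArg Complex.re h'
  have him := congrArg Complex.im h'
  simp only [Complex.mul_re, Complex.mul_im, Complex.ofReal_re, Complex.ofReal_im] at hre him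
  have ha : a.im = 0 := by
    by_contra hne
    have hpos : 0 < a.im := lt_of_le_of_ne h1 (Ne.symm hne)
    have e : (a.re ^ 2 + a.im ^ 2) * b.im = - (r * a.im) := by
      linear_combination a.re * him - a.im * hre
    have := mul_pos hr hpos
    have := mul_nonneg (add_nonneg (sq_nonneg a.re) (sq_nonneg a.im)) h2
    linarith
  have h5 := h3 ha
  rw [h5] at h4
  have h6 := h4 ha
  rw [h6, zero_mul] at h'
  exact hr.ne (by exact_mod_cast h')

/-- Any lossless local passive material is non-dissipative: if `ε` and `μ` are rational,
real-valued on the real axis outside their poles, satisfy the reality principle, and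
`ω ε(ω)`, `ω μ(ω)` are Herglotz, then every complex solution `ω` of the dispersion
relation `ω² ε(ω) μ(ω) = r` (`r > 0` real) is real. -/
theorem lossless_passive_nondissipative (ε μ : RatFunc ℂ)
    (hεloss : ∀ x : ℝ, Polynomial.eval (x : ℂ) ε.denom ≠ 0 →
      (RatFunc.eval (RingHom.id ℂ) (x : ℂ) ε).im = 0)
    (hμloss : ∀ x : ℝ, Polynomial.eval (x : ℂ) μ.denom ≠ 0 →
      (RatFunc.eval (RingHom.id ℂ) (x : ℂ) μ).im = 0)
    (hεreal : ∀ z : ℂ, Polynomial.eval z ε.denom ≠ 0 →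
      RatFunc.eval (RingHom.id ℂ) (-(starRingEnd ℂ z)) ε
        = starRingEnd ℂ (RatFunc.eval (RingHom.id ℂ) z ε))
    (hμreal : ∀ z : ℂ, Polynomial.eval z μ.denom ≠ 0 →
      RatFunc.eval (RingHom.id ℂ) (-(starRingEnd ℂ z)) μ
        = starRingEnd ℂ (RatFunc.eval (RingHom.id ℂ) z μ))
    (hεH : IsHerglotz (fun z : ℂ => z * RatFunc.eval (RingHom.id ℂ) z ε))
    (hμH : IsHerglotz (fun z : ℂ => z * RatFunc.eval (RingHom.id ℂ) z μ)) :
    ∀ r : ℝ, 0 < r → ∀ ω : ℂ,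
      Polynomial.eval ω ε.denom ≠ 0 → Polynomial.eval ω μ.denom ≠ 0 →
      ω ^ 2 * RatFunc.eval (RingHom.id ℂ) ω ε * RatFunc.eval (RingHom.id ℂ) ω μ = (r : ℂ) →
      ω.im = 0 := by
  intro r hr w hd1 hd2 h
  rcases lt_trichotomy w.im 0 with hw | hw | hw
  · exfalso
    apply upper_aux ε μ hεreal hεH hμH r hr (starRingEnd ℂ w) (by simpa using hw)
    rw [(loss_aux ε hεloss w hd1).2, (loss_aux μ hμloss w hd2).2, ← map_pow, ← map_mul,
      ← map_mul, h, Complex.conj_ofReal]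
  · exact hw
  · exact (upper_aux ε μ hεreal hεH hμH r hr w hw h).elim
end

section
/- Let ε₀ > 0, N ∈ ℕ, ω_ℓ ∈ ℝ and Ω_ℓ > 0 for 1 ≤ ℓ ≤ N, and let ε(ω) = ε₀ (1 + Σ_{ℓ=1}^{N} Ω_ℓ²/(ω_ℓ² − ω²)) be a generalized Lorentz permittivity. Then for every real ω that is not a pole of ε, the derivative of ω ↦ ω ε(ω) at ω equals ε₀ (1 + Σ_{ℓ=1}^{N} Ω_ℓ² (ω_ℓ² + ω²)/(ω_ℓ² − ω²)²) and is strictly positive (the growing property). -/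
/-- The growing property of generalized Lorentz materials: for
`ε(ω) = ε₀ (1 + Σ_ℓ Ω_ℓ²/(ω_ℓ² - ω²))` with `ε₀ > 0`, `ω_ℓ ∈ ℝ`, `Ω_ℓ > 0`, and every real
`x` that is not a pole of `ε`, the derivative of `ω ↦ ω ε(ω)` at `x` equals
`ε₀ (1 + Σ_ℓ Ω_ℓ² (ω_ℓ² + x²)/(ω_ℓ² - x²)²)` and is strictly positive. -/
theorem generalized_lorentz_growing_property (ε₀ : ℝ) (hε₀ : 0 < ε₀) (N : ℕ)
    (w Ω : Fin N → ℝ) (hΩ : ∀ ℓ, 0 < Ω ℓ) (x : ℝ) (hx : ∀ ℓ, (w ℓ) ^ 2 - x ^ 2 ≠ 0) :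
    HasDerivAt (fun t : ℝ => t * (ε₀ * (1 + ∑ ℓ, (Ω ℓ) ^ 2 / ((w ℓ) ^ 2 - t ^ 2))))
      (ε₀ * (1 + ∑ ℓ, (Ω ℓ) ^ 2 * ((w ℓ) ^ 2 + x ^ 2) / ((w ℓ) ^ 2 - x ^ 2) ^ 2)) x ∧
    0 < ε₀ * (1 + ∑ ℓ, (Ω ℓ) ^ 2 * ((w ℓ) ^ 2 + x ^ 2) / ((w ℓ) ^ 2 - x ^ 2) ^ 2) := by
  constructor
  · have h1 : ∀ ℓ ∈ (Finset.univ : Finset (Fin N)),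
        HasDerivAt (fun t : ℝ => t * ((Ω ℓ) ^ 2 / ((w ℓ) ^ 2 - t ^ 2)))
          ((Ω ℓ) ^ 2 * ((w ℓ) ^ 2 + x ^ 2) / ((w ℓ) ^ 2 - x ^ 2) ^ 2) x := by
      intro ℓ _
      have hd : HasDerivAt (fun t : ℝ => (w ℓ) ^ 2 - t ^ 2) (-(2 * x)) x := by
        simpa using ((hasDerivAt_id x).pow 2).const_sub ((w ℓ) ^ 2)
      have h := (hasDerivAt_id x).mul ((hasDerivAt_const x ((Ω ℓ) ^ 2)).div hd (hx ℓ))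
      refine h.congr_deriv ?_
      have := hx ℓ
      simp only [id, Pi.div_apply]
      field_simp
      ring
    have h2 := ((hasDerivAt_id x).add (HasDerivAt.fun_sum h1)).const_mul ε₀
    refine h2.congr_of_eventuallyEq (Filter.Eventually.of_forall fun t => ?_)
    simp only [Pi.add_apply, id, ← Finset.mul_sum]
    ring
  · have : 0 ≤ ∑ ℓ, (Ω ℓ) ^ 2 * ((w ℓ) ^ 2 + x ^ 2) / ((w ℓ) ^ 2 - x ^ 2) ^ 2 :=
      Finset.sum_nonneg fun ℓ _ => by positivity
    positivity
end

section
/- Let ε(ω) = ε₀ (1 + Σ_{ℓ=1}^{N_e} Ω_{e,ℓ}²/(ω_{e,ℓ}² − ω²)) and μ(ω) = μ₀ (1 + Σ_{ℓ=1}^{N_m} Ω_{m,ℓ}²/(ω_{m,ℓ}² − ω²)) be generalized Lorentz permittivity and permeability (ε₀, μ₀ > 0, ω_{e,ℓ}, ω_{m,ℓ} ∈ ℝ, Ω_{e,ℓ}, Ω_{m,ℓ} > 0), and set F(ω) = ω² ε(ω) μ(ω). Then at every real ω that is not a pole of ε or μ and at which F(ω) > 0, the derivative F′(ω) is nonzero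 and has the same sign as ω ε(ω) (equivalently, F′(ω) · ω ε(ω) > 0). -/
/-- Derivative of a Lorentz function, with positivity of the derivative of `t * e(t)`. -/
theorem lorentz_aux (e₀ : ℝ) (he₀ : 0 < e₀) (N : ℕ) (w Ω : Fin N → ℝ)
    (x : ℝ) (hx : ∀ ℓ, (w ℓ) ^ 2 - x ^ 2 ≠ 0) :
    ∃ d : ℝ, HasDerivAt (fun t : ℝ => e₀ * (1 + ∑ ℓ, (Ω ℓ) ^ 2 / ((w ℓ) ^ 2 - t ^ 2))) d x ∧
      0 < e₀ * (1 + ∑ ℓ, (Ω ℓ) ^ 2 / ((w ℓ) ^ 2 - x ^ 2)) + x * d := by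
  refine ⟨e₀ * ∑ ℓ, (Ω ℓ) ^ 2 * (2 * x) / ((w ℓ) ^ 2 - x ^ 2) ^ 2, ?_, ?_⟩
  · refine HasDerivAt.const_mul _ (HasDerivAt.const_add _ (HasDerivAt.fun_sum fun ℓ _ => ?_))
    have h1 : HasDerivAt (fun t : ℝ => (w ℓ) ^ 2 - t ^ 2) (-(2 * x)) x := by
      simpa using (hasDerivAt_pow 2 x).const_sub ((w ℓ) ^ 2)
    have h2 := (hasDerivAt_const x ((Ω ℓ) ^ 2)).fun_div h1 (hx ℓ)
    refine h2.congr_deriv ?_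
    ring
  · have h : e₀ * (1 + ∑ ℓ, (Ω ℓ) ^ 2 / ((w ℓ) ^ 2 - x ^ 2))
        + x * (e₀ * ∑ ℓ, (Ω ℓ) ^ 2 * (2 * x) / ((w ℓ) ^ 2 - x ^ 2) ^ 2)
        = e₀ * (1 + ∑ ℓ, (Ω ℓ) ^ 2 * ((w ℓ) ^ 2 + x ^ 2) / ((w ℓ) ^ 2 - x ^ 2) ^ 2) := by
      have : ∑ ℓ, (Ω ℓ) ^ 2 * ((w ℓ) ^ 2 + x ^ 2) / ((w ℓ) ^ 2 - x ^ 2) ^ 2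
          = ∑ ℓ, (Ω ℓ) ^ 2 / ((w ℓ) ^ 2 - x ^ 2)
            + x * ∑ ℓ, (Ω ℓ) ^ 2 * (2 * x) / ((w ℓ) ^ 2 - x ^ 2) ^ 2 := by
        rw [Finset.mul_sum, ← Finset.sum_add_distrib]
        refine Finset.sum_congr rfl fun ℓ _ => ?_
        have := hx ℓ
        field_simp
        ring
      rw [this]
      ring
    rw [h]
    have : 0 ≤ ∑ ℓ, (Ω ℓ) ^ 2 * ((w ℓ) ^ 2 + x ^ 2) / ((w ℓ) ^ 2 - x ^ 2) ^ 2 :=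
      Finset.sum_nonneg fun ℓ _ => by positivity
    positivity

/-- For generalized Lorentz permittivity and permeability
`ε(ω) = ε₀ (1 + Σ_ℓ Ω_{e,ℓ}²/(ω_{e,ℓ}² - ω²))`, `μ(ω) = μ₀ (1 + Σ_ℓ Ω_{m,ℓ}²/(ω_{m,ℓ}² - ω²))`
and `F(ω) = ω² ε(ω) μ(ω)`, at every real `x` which is not a pole of `ε` or `μ` and at which
`F(x) > 0`, the derivative `F'(x)` is nonzero with the same sign as `x ε(x)`,
i.e. `F'(x) · x ε(x) > 0`. -/
theorem lorentz_dispersion_monotone (ε₀ μ₀ : ℝ) (hε₀ : 0 < ε₀) (hμ₀ : 0 < μ₀)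
    (Ne Nm : ℕ) (we Ωe : Fin Ne → ℝ) (wm Ωm : Fin Nm → ℝ)
    (hΩe : ∀ ℓ, 0 < Ωe ℓ) (hΩm : ∀ ℓ, 0 < Ωm ℓ)
    (x : ℝ) (hxe : ∀ ℓ, (we ℓ) ^ 2 - x ^ 2 ≠ 0) (hxm : ∀ ℓ, (wm ℓ) ^ 2 - x ^ 2 ≠ 0)
    (hFpos : 0 < x ^ 2 * (ε₀ * (1 + ∑ ℓ, (Ωe ℓ) ^ 2 / ((we ℓ) ^ 2 - x ^ 2)))
        * (μ₀ * (1 + ∑ ℓ, (Ωm ℓ) ^ 2 / ((wm ℓ) ^ 2 - x ^ 2)))) :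
    0 < deriv (fun t : ℝ => t ^ 2 * (ε₀ * (1 + ∑ ℓ, (Ωe ℓ) ^ 2 / ((we ℓ) ^ 2 - t ^ 2)))
          * (μ₀ * (1 + ∑ ℓ, (Ωm ℓ) ^ 2 / ((wm ℓ) ^ 2 - t ^ 2)))) x
        * (x * (ε₀ * (1 + ∑ ℓ, (Ωe ℓ) ^ 2 / ((we ℓ) ^ 2 - x ^ 2)))) := by
  obtain ⟨d, hd, hdp⟩ := lorentz_aux ε₀ hε₀ Ne we Ωe x hxe
  obtain ⟨b, hb, hbp⟩ := lorentz_aux μ₀ hμ₀ Nm wm Ωm x hxm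
  have hF := ((hasDerivAt_pow 2 x).fun_mul hd).fun_mul hb
  rw [hF.deriv]
  generalize ε₀ * (1 + ∑ ℓ, (Ωe ℓ) ^ 2 / ((we ℓ) ^ 2 - x ^ 2)) = e at *
  generalize μ₀ * (1 + ∑ ℓ, (Ωm ℓ) ^ 2 / ((wm ℓ) ^ 2 - x ^ 2)) = m at *
  have h1 := mul_pos hdp hFpos
  have h2 := mul_nonneg (sq_nonneg (x * e)) hbp.le
  refine lt_of_lt_of_eq (add_pos_of_pos_of_nonneg h1 h2) ?_
  push_cast
  ring
end

section
/- (Nevanlinna representation theorem) A function f : ℂ⁺ → ℂ is a Herglotz function if and only if there exist α ≥ 0, β ∈ ℝ, and a positive Borel measure ν on ℝ with ∫_ℝ dν(ξ)/(1+ξ²) < ∞ such that f(ω) = α ω + β + ∫_ℝ (1/(ξ − ω) − ξ/(1+ξ²)) dν(ξ) for every ω ∈ ℂ⁺. Moreover, in this representation α = lim_{y→+∞} f(iy)/(iy) and β = Re f(i). -/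
open Complex MeasureTheory Filter

noncomputable def nevK (ξ : ℝ) (ω : ℂ) : ℂ := ((ξ : ℂ) - ω)⁻¹ - (ξ : ℂ) / (1 + (ξ : ℂ) ^ 2)

lemma nev_one_add (ξ : ℝ) : (1 + (ξ : ℂ) ^ 2) ≠ 0 := by
  have : (0:ℝ) < 1 + ξ ^ 2 := by positivity
  exact_mod_cast this.ne'

lemma nev_sub_ne (ξ : ℝ) {ω : ℂ} (h : 0 < ω.im) : (ξ : ℂ) - ω ≠ 0 := by
  intro h0
  have := congrArg Complex.im h0
  simp at this
  exact h.ne' this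

lemma nev_norm_sub (ξ : ℝ) {ω : ℂ} (h : 0 < ω.im) : ω.im ≤ ‖(ξ : ℂ) - ω‖ := by
  have := Complex.abs_im_le_norm ((ξ : ℂ) - ω)
  simp [abs_of_pos h] at this
  exact this

lemma nevK_eq (ξ : ℝ) {ω : ℂ} (h : 0 < ω.im) :
    nevK ξ ω = (((1 + ξ ^ 2)⁻¹ : ℝ) : ℂ) * (ω + (1 + ω ^ 2) * ((ξ : ℂ) - ω)⁻¹) := by
  have h1 := nev_one_add ξ
  have h2 := nev_sub_ne ξ h
  unfold nevK
  push_cast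
  field_simp
  ring

lemma nevK_norm (ξ : ℝ) {ω : ℂ} (h : 0 < ω.im) :
    ‖nevK ξ ω‖ ≤ (‖ω‖ + (1 + ‖ω‖ ^ 2) / ω.im) * (1 + ξ ^ 2)⁻¹ := by
  rw [nevK_eq ξ h, norm_mul, mul_comm, Complex.norm_real, Real.norm_of_nonneg (by positivity)]
  gcongr
  refine (norm_add_le _ _).trans ?_
  gcongr
  rw [norm_mul, norm_inv, div_eq_mul_inv]
  have := nev_norm_sub ξ h
  gcongr
  refine (norm_add_le _ _).trans ?_
  simp

lemma nevK_meas (ω : ℂ) : Measurable (fun ξ : ℝ => nevK ξ ω) := by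
  unfold nevK
  fun_prop

lemma nevK_integrable {ν : Measure ℝ} (hν : Integrable (fun ξ : ℝ => (1 + ξ ^ 2)⁻¹) ν)
    {ω : ℂ} (h : 0 < ω.im) : Integrable (fun ξ : ℝ => nevK ξ ω) ν :=
  (hν.const_mul _).mono' (nevK_meas ω).aestronglyMeasurable
    (ae_of_all _ fun ξ => nevK_norm ξ h)

lemma nevK_im (ξ : ℝ) (ω : ℂ) : (nevK ξ ω).im = ω.im / normSq ((ξ : ℂ) - ω) := by
  have : (ξ : ℂ) / (1 + (ξ : ℂ) ^ 2) = ((ξ / (1 + ξ ^ 2) : ℝ) : ℂ) := by push_cast; rfl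
  unfold nevK
  rw [this, sub_im, ofReal_im, inv_im]
  simp

lemma nev_sq_bound (ξ : ℝ) {ω : ℂ} (h : 0 < ω.im) :
    ‖(((ξ : ℂ) - ω) ^ 2)⁻¹‖ ≤ (1 + ‖ω - I‖ / ω.im) ^ 2 * (1 + ξ ^ 2)⁻¹ := by
  have h1 : ‖(ξ : ℂ) - I‖ ^ 2 = 1 + ξ ^ 2 := by
    rw [← Complex.normSq_eq_norm_sq, normSq_apply]; simp; ring
  have h2 := nev_norm_sub ξ h
  have h3 : ‖(ξ : ℂ) - I‖ ≤ (1 + ‖ω - I‖ / ω.im) * ‖(ξ : ℂ) - ω‖ := by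
    calc ‖(ξ : ℂ) - I‖ = ‖((ξ : ℂ) - ω) + (ω - I)‖ := by ring_nf
      _ ≤ ‖(ξ : ℂ) - ω‖ + ‖ω - I‖ := norm_add_le _ _
      _ ≤ ‖(ξ : ℂ) - ω‖ + ‖ω - I‖ / ω.im * ‖(ξ : ℂ) - ω‖ := by
        gcongr
        rw [div_mul_eq_mul_div, le_div_iff₀ h]
        gcongr
      _ = _ := by ring
  have h4 : 0 < ‖(ξ : ℂ) - ω‖ := h.trans_le h2
  rw [norm_inv, norm_pow, ← h1, inv_eq_one_div, ← div_eq_mul_inv, div_le_div_iff₀ (by positivity)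
    (by rw [h1]; positivity), one_mul, ← mul_pow]
  gcongr

lemma nevK_diff {ν : Measure ℝ} (hν : Integrable (fun ξ : ℝ => (1 + ξ ^ 2)⁻¹) ν) :
    DifferentiableOn ℂ (fun ω => ∫ ξ : ℝ, nevK ξ ω ∂ν) {z : ℂ | 0 < z.im} := by
  intro ω₀ h₀
  have h₀ : 0 < ω₀.im := h₀
  have him : ∀ x ∈ Metric.ball ω₀ (ω₀.im / 2), ω₀.im / 2 < x.im := by
    intro x hx
    have := (Complex.abs_im_le_norm (x - ω₀)).trans_lt (mem_ball_iff_norm.1 hx)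
    have := (abs_lt.1 this).1
    simp at this
    linarith
  refine (hasDerivAt_integral_of_dominated_loc_of_deriv_le (F := fun ω ξ => nevK ξ ω)
    (F' := fun ω ξ => (((ξ : ℂ) - ω) ^ 2)⁻¹) (s := Metric.ball ω₀ (ω₀.im / 2))
    (bound := fun ξ => (1 + (ω₀.im / 2 + ‖ω₀ - I‖) / (ω₀.im / 2)) ^ 2 * (1 + ξ ^ 2)⁻¹)
    (Metric.ball_mem_nhds _ (by linarith)) ?_ (nevK_integrable hν h₀) ?_ ?_
    (hν.const_mul _) ?_).2.differentiableAt.differentiableWithinAt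
  · exact Eventually.of_forall fun x => (nevK_meas x).aestronglyMeasurable
  · exact Measurable.aestronglyMeasurable (by fun_prop)
  · refine ae_of_all _ fun ξ x hx => ?_
    have hx' := him x hx
    refine (nev_sq_bound ξ (by linarith)).trans ?_
    have : ‖x - I‖ ≤ ω₀.im / 2 + ‖ω₀ - I‖ := by
      calc ‖x - I‖ = ‖(x - ω₀) + (ω₀ - I)‖ := by ring_nf
        _ ≤ _ := (norm_add_le _ _).trans (by gcongr; exact (mem_ball_iff_norm.1 hx).le)
    have hx0 : 0 < x.im := by linarith
    have : 0 ≤ 1 + ‖x - I‖ / x.im := by positivity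
    gcongr
  · refine ae_of_all _ fun ξ x hx => ?_
    have hx' := him x hx
    have hne := nev_sub_ne ξ (ω := x) (by linarith)
    have := (((hasDerivAt_id x).const_sub (ξ : ℂ)).inv hne).sub_const ((ξ : ℂ) / (1 + (ξ : ℂ) ^ 2))
    have h3 : - -1 / ((ξ : ℂ) - id x) ^ 2 = (((ξ : ℂ) - x) ^ 2)⁻¹ := by simp
    rw [h3] at this
    exact this

lemma nevK_int_im {ν : Measure ℝ} (hν : Integrable (fun ξ : ℝ => (1 + ξ ^ 2)⁻¹) ν)
    {ω : ℂ} (h : 0 < ω.im) : (∫ ξ : ℝ, nevK ξ ω ∂ν).im = ∫ ξ : ℝ, (nevK ξ ω).im ∂ν :=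
  (imCLM.integral_comp_comm (nevK_integrable hν h)).symm

lemma nev_limit {ν : Measure ℝ} (hν : Integrable (fun ξ : ℝ => (1 + ξ ^ 2)⁻¹) ν) :
    Tendsto (fun y : ℝ => (∫ ξ : ℝ, nevK ξ (I * y) ∂ν) / (I * y)) atTop (nhds 0) := by
  have key : Tendsto (fun y : ℝ => ∫ ξ : ℝ, nevK ξ (I * y) / (I * y) ∂ν) atTop
      (nhds (∫ ξ : ℝ, (0:ℂ) ∂ν)) := by
    refine tendsto_integral_filter_of_dominated_convergence (fun ξ => 3 * (1 + ξ ^ 2)⁻¹)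
      (Eventually.of_forall fun y => ((nevK_meas _).div_const _).aestronglyMeasurable) ?_
      (hν.const_mul _) (ae_of_all _ fun ξ => ?_)
    · filter_upwards [eventually_ge_atTop 1] with y hy
      refine ae_of_all _ fun ξ => ?_
      have h := nevK_norm ξ (ω := I * y) (by simp; linarith)
      have hn : ‖I * (y : ℂ)‖ = y := by simp; linarith
      have hy0 : (0:ℝ) < y := by linarith
      rw [norm_div, hn, div_le_iff₀ hy0]
      refine h.trans ?_
      rw [hn]
      have : (I * (y:ℂ)).im = y := by simp
      rw [this]
      have : y + (1 + y ^ 2) / y ≤ 3 * y := by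
        have : (1 + y ^ 2) / y ≤ 2 * y := by rw [div_le_iff₀ hy0]; nlinarith
        linarith
      calc _ ≤ (3 * y) * (1 + ξ ^ 2)⁻¹ := by gcongr
        _ = _ := by ring
    · set c := ‖(ξ : ℂ) / (1 + (ξ : ℂ) ^ 2)‖
      have hlim : Tendsto (fun y : ℝ => (1 + c) * y⁻¹) atTop (nhds 0) := by
        simpa using tendsto_inv_atTop_zero.const_mul (1 + c)
      refine squeeze_zero_norm' ?_ hlim
      filter_upwards [eventually_ge_atTop 1] with y hy
      have hn : ‖I * (y : ℂ)‖ = y := by simp; linarith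
      have h2 := nev_norm_sub ξ (ω := I * y) (by simp; linarith)
      have : (I * (y:ℂ)).im = y := by simp
      rw [this] at h2
      rw [norm_div, hn, div_eq_mul_inv]
      gcongr
      unfold nevK
      refine (norm_sub_le _ _).trans ?_
      gcongr
      rw [norm_inv]
      exact inv_le_one_of_one_le₀ (hy.trans h2)
  simpa [integral_div] using key

lemma nev_re_I {ν : Measure ℝ} (hν : Integrable (fun ξ : ℝ => (1 + ξ ^ 2)⁻¹) ν) :
    (∫ ξ : ℝ, nevK ξ I ∂ν).re = 0 := by
  have : (∫ ξ : ℝ, nevK ξ I ∂ν).re = ∫ ξ : ℝ, (nevK ξ I).re ∂ν :=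
    (reCLM.integral_comp_comm (nevK_integrable hν (by simp))).symm
  rw [this]
  refine integral_eq_zero_of_ae (ae_of_all _ fun ξ => ?_)
  have h2 : (ξ : ℂ) / (1 + (ξ : ℂ) ^ 2) = ((ξ / (1 + ξ ^ 2) : ℝ) : ℂ) := by push_cast; rfl
  simp only [nevK, h2, sub_re, inv_re, ofReal_re, normSq_apply]
  simp
  ring

lemma nev_moreover (f : ℂ → ℂ) (α β : ℝ) (ν : Measure ℝ)
    (hν : Integrable (fun ξ : ℝ => (1 + ξ ^ 2)⁻¹) ν)
    (hf : ∀ ω : ℂ, 0 < ω.im → f ω = (α : ℂ) * ω + (β : ℂ) + ∫ ξ : ℝ, nevK ξ ω ∂ν) :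
      Tendsto (fun y : ℝ => f (Complex.I * (y : ℂ)) / (Complex.I * (y : ℂ)))
          atTop (nhds (α : ℂ)) ∧ β = (f Complex.I).re := by
  constructor
  · have h1 : Tendsto (fun y : ℝ => (β : ℂ) / (I * y)) atTop (nhds 0) := by
      have : Tendsto (fun y : ℝ => |β| * y⁻¹) atTop (nhds 0) := by
        simpa using tendsto_inv_atTop_zero.const_mul |β|
      refine squeeze_zero_norm' ?_ this
      filter_upwards [eventually_ge_atTop 1] with y hy
      simp [div_eq_mul_inv, abs_of_nonneg (zero_le_one.trans hy)]
    have h2 := (tendsto_const_nhds (x := (α : ℂ))).add (h1.add (nev_limit hν))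
    simp only [add_zero] at h2
    refine h2.congr' ?_
    filter_upwards [eventually_ge_atTop 1] with y hy
    rw [hf _ (by simp; linarith)]
    have : (I * (y : ℂ)) ≠ 0 := by
      simp; linarith
    rw [add_div, add_div, mul_div_cancel_right₀ _ this]
    ring
  · rw [hf I (by simp)]
    simp [nev_re_I hν]

lemma nev_converse (f : ℂ → ℂ) (α β : ℝ) (ν : Measure ℝ) (hα : 0 ≤ α)
    (hν : Integrable (fun ξ : ℝ => (1 + ξ ^ 2)⁻¹) ν)
    (hf : ∀ ω : ℂ, 0 < ω.im → f ω = (α : ℂ) * ω + (β : ℂ) + ∫ ξ : ℝ, nevK ξ ω ∂ν) :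
    IsHerglotz f := by
  constructor
  · refine DifferentiableOn.congr (f := fun ω => (α : ℂ) * ω + (β : ℂ) + ∫ ξ : ℝ, nevK ξ ω ∂ν)
      ?_ (fun ω h => hf ω h)
    exact DifferentiableOn.add (by fun_prop) (nevK_diff hν)
  · intro ω h
    rw [hf ω h]
    simp only [add_im, nevK_int_im hν h, nevK_im, mul_im, ofReal_re, ofReal_im]
    have : 0 ≤ ∫ ξ : ℝ, ω.im / normSq ((ξ : ℂ) - ω) ∂ν :=
      integral_nonneg fun ξ => div_nonneg h.le (normSq_nonneg _)
    have := mul_nonneg hα h.le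
    linarith

lemma nev_uniq_const (f g : ℂ → ℂ) (hf : DifferentiableOn ℂ f {z : ℂ | 0 < z.im})
    (hg : DifferentiableOn ℂ g {z : ℂ | 0 < z.im})
    (h : ∀ z : ℂ, 0 < z.im → (f z).im = (g z).im) :
    ∃ β : ℝ, ∀ z : ℂ, 0 < z.im → f z = g z + β := by
  have hU : IsOpen {z : ℂ | 0 < z.im} := isOpen_lt continuous_const continuous_im
  have hc : Convex ℝ {z : ℂ | 0 < z.im} := convex_halfSpace_im_gt 0
  obtain ⟨c, hcc⟩ := AnalyticOnNhd.eq_const_of_im_eq_const (c₀ := 0)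
    ((hf.sub hg).analyticOnNhd hU) (fun z hz => by simp [h z hz]) hU
    ⟨⟨I, by simp⟩, hc.isPreconnected⟩
  refine ⟨c.re, fun z hz => ?_⟩
  have h1 := hcc z hz
  simp only [Pi.sub_apply] at h1
  have h2 : c.im = 0 := by
    have := congrArg Complex.im h1
    simp [h z hz] at this
    exact this.symm
  have : ((c.re : ℝ) : ℂ) = c := by apply Complex.ext <;> simp [h2]
  rw [this, ← h1]; ring
lemma nev_poisson_bcf {w : ℂ} (hw : ‖w‖ < 1) :
    Continuous (fun θ : ℝ => poissonKernel 0 w (circleMap 0 1 θ)) ∧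
    ∀ θ : ℝ, ‖poissonKernel 0 w (circleMap 0 1 θ)‖ ≤ (1 - ‖w‖ ^ 2) / (1 - ‖w‖) ^ 2 := by
  have hn : ∀ θ : ℝ, ‖circleMap 0 1 θ‖ = 1 := fun θ => by simp
  have hl : ∀ θ : ℝ, 1 - ‖w‖ ≤ ‖circleMap 0 1 θ - w‖ := fun θ => by
    have := norm_sub_norm_le (circleMap 0 1 θ) w
    rwa [hn] at this
  have e : (fun θ : ℝ => poissonKernel 0 w (circleMap 0 1 θ)) =
      fun θ : ℝ => (1 - ‖w‖ ^ 2) / ‖circleMap 0 1 θ - w‖ ^ 2 := by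
    ext θ
    simp [poissonKernel_def, hn]
  constructor
  · rw [e]
    refine Continuous.div (by fun_prop) (by fun_prop) fun θ => ?_
    have := hl θ
    have : 0 < ‖circleMap 0 1 θ - w‖ := by linarith
    positivity
  · intro θ
    have e2 := congrFun e θ
    have h0 := norm_nonneg w
    have h1 : 0 ≤ 1 - ‖w‖ ^ 2 := by nlinarith
    have h2 : 0 < 1 - ‖w‖ := by linarith
    rw [e2, Real.norm_of_nonneg (by positivity)]
    have := hl θ
    gcongr

lemma nev_disc (G : ℂ → ℂ) (hG : DifferentiableOn ℂ G (Metric.ball 0 1))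
    (hpos : ∀ w : ℂ, ‖w‖ < 1 → 0 ≤ (G w).re) :
    ∃ μ : Measure ℝ, IsFiniteMeasure μ ∧ ∀ w : ℂ, ‖w‖ < 1 →
      (G w).re = ∫ θ : ℝ, poissonKernel 0 w (circleMap 0 1 θ) ∂μ := by
  have hpi := Real.two_pi_pos
  let r : ℕ → ℝ := fun n => 1 - 1 / ((n : ℝ) + 1)
  have hr0 : ∀ n, 0 ≤ r n := fun n => by
    have : 1 / ((n : ℝ) + 1) ≤ 1 := by
      rw [div_le_one (by positivity)]; linarith [Nat.cast_nonneg (α := ℝ) n]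
    simp only [r]; linarith
  have hr1 : ∀ n, r n < 1 := fun n => by
    have : 0 < 1 / ((n : ℝ) + 1) := by positivity
    simp only [r]; linarith
  have hrlim : Tendsto r atTop (nhds 1) := by
    simpa [r] using (tendsto_one_div_add_atTop_nhds_zero_nat (𝕜 := ℝ)).const_sub 1
  let Gn : ℕ → ℂ → ℂ := fun n w => G (r n * w)
  have hmem : ∀ n (w : ℂ), ‖w‖ ≤ 1 → ‖(r n : ℂ) * w‖ < 1 := fun n w hw => by
    rw [norm_mul, Complex.norm_real, Real.norm_of_nonneg (hr0 n)]
    nlinarith [hr0 n, hr1 n, norm_nonneg w]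
  have hGn : ∀ n, DiffContOnCl ℂ (Gn n) (Metric.ball 0 1) := fun n => by
    refine DifferentiableOn.diffContOnCl ?_
    rw [closure_ball _ one_ne_zero]
    refine hG.comp (by fun_prop) fun w hw => ?_
    simpa using hmem n w (by simpa using hw)
  have hcont : ∀ n, Continuous (fun θ : ℝ => (Gn n (circleMap 0 1 θ))) := fun n => by
    have := (hGn n).continuousOn
    rw [closure_ball _ one_ne_zero] at this
    exact this.comp_continuous (by fun_prop) fun θ => by simp
  let ρ : ℕ → ℝ → ℝ := fun n θ => (2 * Real.pi)⁻¹ * (Gn n (circleMap 0 1 θ)).re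
  have hρc : ∀ n, Continuous (ρ n) := fun n =>
    continuous_const.mul (continuous_re.comp (hcont n))
  have hρ0 : ∀ n θ, 0 ≤ ρ n θ := fun n θ =>
    mul_nonneg (by positivity) (hpos _ (hmem n _ (by simp)))
  let m : ℕ → Measure ℝ := fun n =>
    (volume.restrict (Set.Ioc 0 (2 * Real.pi))).withDensity fun θ => ENNReal.ofReal (ρ n θ)
  have hint : ∀ n (g : ℝ → ℝ), ∫ θ, g θ ∂(m n) = ∫ θ in Set.Ioc 0 (2 * Real.pi), ρ n θ * g θ := by
    intro n g
    simp only [m]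
    rw [integral_withDensity_eq_integral_toReal_smul (f := fun θ => ENNReal.ofReal (ρ n θ))
      (ENNReal.measurable_ofReal.comp (hρc n).measurable) (by simp)]
    simp only [ENNReal.toReal_ofReal (hρ0 n _), smul_eq_mul]
  have hpois : ∀ n (w : ℂ), ‖w‖ < 1 →
      ∫ θ, poissonKernel 0 w (circleMap 0 1 θ) ∂(m n) = (Gn n w).re := by
    intro n w hw
    have h := (hGn n).circleAverage_poissonKernel_smul (w := w) (by simpa using hw)
    rw [Real.circleAverage_def, intervalIntegral.integral_of_le hpi.le] at h
    have hi : IntegrableOn (fun θ : ℝ => (poissonKernel 0 w • Gn n) (circleMap 0 1 θ))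
        (Set.Ioc 0 (2 * Real.pi)) := by
      have : Continuous (fun θ : ℝ => (poissonKernel 0 w • Gn n) (circleMap 0 1 θ)) :=
        (nev_poisson_bcf hw).1.smul (hcont n)
      exact this.integrableOn_Ioc
    have h2 := congrArg Complex.re h
    rw [hint, ← h2, Complex.smul_re, smul_eq_mul]
    have h3 : (∫ θ in Set.Ioc 0 (2 * Real.pi), (poissonKernel 0 w • Gn n) (circleMap 0 1 θ)).re
      = ∫ θ in Set.Ioc 0 (2 * Real.pi), ((poissonKernel 0 w • Gn n) (circleMap 0 1 θ)).re :=
      (reCLM.integral_comp_comm hi).symm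
    rw [h3, ← integral_const_mul]
    congr 1
    ext θ
    simp [ρ]
    ring
  have hfin : ∀ n, IsFiniteMeasure (m n) := fun n => by
    refine isFiniteMeasure_withDensity_ofReal ?_
    exact ((hρc n).integrableOn_Ioc).2
  let M : ℕ → FiniteMeasure ℝ := fun n => ⟨m n, hfin n⟩
  have hmass : ∀ n, (M n).mass ≤ Real.toNNReal (G 0).re := fun n => by
    have h := hpois n 0 (by simp)
    have : ∀ θ : ℝ, poissonKernel 0 0 (circleMap 0 1 θ) = 1 := fun θ => by
      simp [poissonKernel_def]
    simp only [this] at h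
    have h2 : ((M n).mass : ℝ) = (G 0).re := by
      have h3 : ((m n) Set.univ).toReal = (G 0).re := by
        simpa [Gn, Measure.real] using h
      exact h3
    rw [← h2]
    simp
  have hsupp : ∀ n, (M n) (Set.Icc 0 (2 * Real.pi))ᶜ = 0 := fun n => by
    have : m n (Set.Icc 0 (2 * Real.pi))ᶜ = 0 := by
      refine withDensity_absolutelyContinuous _ _ ?_
      rw [Measure.restrict_apply (by measurability)]
      convert measure_empty (μ := (volume : Measure ℝ))
      ext x
      simp only [Set.mem_inter_iff, Set.mem_compl_iff, Set.mem_Icc, Set.mem_Ioc]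
      constructor
      · rintro ⟨h, h1, h2⟩
        exact h ⟨h1.le, h2⟩
      · rintro ⟨⟩
    rw [FiniteMeasure.null_iff_toMeasure_null]
    exact this
  obtain ⟨μ, -, hμ⟩ := (isCompact_setOfPred_finiteMeasure_le_of_isCompact
    (Real.toNNReal (G 0).re) (isCompact_Icc (a := (0:ℝ)) (b := 2 * Real.pi))).ultrafilter_le_nhds'
    ((hyperfilter ℕ).map M) (by
      rw [Ultrafilter.mem_map]
      exact univ_mem' fun n => ⟨hmass n, hsupp n⟩)
  have hμ' : Tendsto M (hyperfilter ℕ) (nhds μ) := hμ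
  refine ⟨μ, inferInstance, fun w hw => ?_⟩
  have hb := nev_poisson_bcf hw
  have h1 := FiniteMeasure.tendsto_iff_forall_integral_tendsto.1 hμ'
    (BoundedContinuousFunction.ofNormedAddCommGroup _ hb.1 _ hb.2)
  have h2 : Tendsto (fun n => (Gn n w).re) atTop (nhds (G w).re) := by
    have hc : ContinuousAt G w :=
      (hG.differentiableAt (Metric.isOpen_ball.mem_nhds (by simpa using hw))).continuousAt
    have h3 : Tendsto (fun n => (r n : ℂ) * w) atTop (nhds w) := by
      have := ((continuous_ofReal.tendsto 1).comp hrlim).mul_const w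
      simpa using this
    exact (continuous_re.tendsto _).comp (hc.tendsto.comp h3)
  refine tendsto_nhds_unique (h2.mono_left Nat.hyperfilter_le_atTop) (h1.congr fun n => ?_)
  exact hpois n w hw

noncomputable def nevXi (θ : ℝ) : ℝ := (I * (1 + circleMap 0 1 θ) / (1 - circleMap 0 1 θ)).re

lemma nevXi_meas : Measurable nevXi := by
  have : Measurable (circleMap 0 1) := (continuous_circleMap 0 1).measurable
  unfold nevXi
  fun_prop

lemma nevXi_eq {θ : ℝ} (h : circleMap 0 1 θ ≠ 1) :
    (nevXi θ : ℂ) * (1 - circleMap 0 1 θ) = I * (1 + circleMap 0 1 θ) := by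
  unfold nevXi
  set ζ := circleMap 0 1 θ with hζ
  have hn : normSq ζ = 1 := by rw [Complex.normSq_eq_norm_sq, hζ]; simp
  have h1 : (1 : ℂ) - ζ ≠ 0 := sub_ne_zero.2 h.symm
  have him : (I * (1 + ζ) / (1 - ζ)).im = 0 := by
    rw [normSq_apply] at hn
    rw [Complex.div_im]
    simp
    rw [← sub_div]
    rw [div_eq_zero_iff]
    left
    linarith
  have : (((I * (1 + ζ) / (1 - ζ)).re : ℝ) : ℂ) = I * (1 + ζ) / (1 - ζ) := by
    apply Complex.ext <;> simp only [ofReal_re, ofReal_im, him]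
  rw [this, div_mul_cancel₀ _ h1]

lemma nev_w {ω : ℂ} (h : 0 < ω.im) : ω + I ≠ 0 ∧ ‖(ω - I) / (ω + I)‖ < 1 ∧
    I * (1 + (ω - I) / (ω + I)) / (1 - (ω - I) / (ω + I)) = ω := by
  have h1 : ω + I ≠ 0 := by
    intro h0
    have := congrArg Complex.im h0
    simp at this
    linarith
  refine ⟨h1, ?_, ?_⟩
  · rw [norm_div, div_lt_one (norm_pos_iff.2 h1), ← sq_lt_sq₀ (norm_nonneg _) (norm_nonneg _),
      ← Complex.normSq_eq_norm_sq, ← Complex.normSq_eq_norm_sq, normSq_apply, normSq_apply]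
    simp
    nlinarith
  · have e1 : 1 - (ω - I) / (ω + I) = 2 * I / (ω + I) := by field_simp; ring
    have e2 : 1 + (ω - I) / (ω + I) = 2 * ω / (ω + I) := by field_simp; ring
    rw [e1, e2]
    field_simp

lemma nev_kernel_compl {ω : ℂ} (h : 0 < ω.im) {θ : ℝ} (hθ : circleMap 0 1 θ ≠ 1) :
    poissonKernel 0 ((ω - I) / (ω + I)) (circleMap 0 1 θ) =
      (1 + nevXi θ ^ 2) * (nevK (nevXi θ) ω).im := by
  obtain ⟨h1, h2, -⟩ := nev_w h
  have hx := nevXi_eq hθ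
  set ξ := nevXi θ
  set ζ := circleMap 0 1 θ with hζ
  have hn : ‖ζ‖ = 1 := by rw [hζ]; simp
  have hne : ζ - (ω - I) / (ω + I) ≠ 0 := by
    intro h0
    rw [sub_eq_zero] at h0
    rw [← h0, hn] at h2
    exact lt_irrefl _ h2
  have h3 := nev_sub_ne ξ h
  have hK : herglotzRieszKernel 0 ((ω - I) / (ω + I)) ζ * ((ξ : ℂ) - ω) = - I * (1 + ξ * ω) := by
    rw [herglotzRieszKernel_def]
    simp only [sub_zero]
    rw [div_mul_eq_mul_div, div_eq_iff hne]
    field_simp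
    have hI := I_sq
    linear_combination (-I * (1 + ω ^ 2)) * hx + (ζ + 1) * ω * (ξ - ω) * hI
  have hK2 : herglotzRieszKernel 0 ((ω - I) / (ω + I)) ζ
      = -I * ((((1 + ξ ^ 2 : ℝ)) : ℂ) * nevK ξ ω) := by
    rw [nevK_eq ξ h, ← mul_assoc, ← mul_assoc, mul_assoc (-I), ← ofReal_mul,
      mul_inv_cancel₀ (by positivity), eq_div_of_mul_eq h3 hK]
    field_simp
    push_cast
    ring
  rw [poissonKernel_eq_re_herglotzRieszKernel, Function.comp_apply, hK2]
  simp [-ofReal_add]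

lemma nev_kernel_one {ω : ℂ} (h : 0 < ω.im) :
    poissonKernel 0 ((ω - I) / (ω + I)) 1 = ω.im := by
  obtain ⟨h1, h2, h3⟩ := nev_w h
  have : herglotzRieszKernel 0 ((ω - I) / (ω + I)) 1 = -I * ω := by
    rw [herglotzRieszKernel_def]
    simp only [sub_zero]
    conv_rhs => rw [← h3]
    rw [← mul_div_assoc, ← mul_assoc]
    simp
  rw [poissonKernel_eq_re_herglotzRieszKernel, Function.comp_apply, this]
  simp

lemma nev_forward (f : ℂ → ℂ) (hf : IsHerglotz f) :
    ∃ (α β : ℝ) (ν : Measure ℝ), 0 ≤ α ∧ Integrable (fun ξ : ℝ => (1 + ξ ^ 2)⁻¹) ν ∧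
      ∀ ω : ℂ, 0 < ω.im → f ω = (α : ℂ) * ω + (β : ℂ) + ∫ ξ : ℝ, nevK ξ ω ∂ν := by
  have hmap : ∀ w : ℂ, ‖w‖ < 1 → 0 < (I * (1 + w) / (1 - w)).im ∧ 1 - w ≠ 0 := by
    intro w hw
    have hne : 1 - w ≠ 0 := by
      intro h0
      rw [sub_eq_zero] at h0
      rw [← h0] at hw
      simp at hw
    refine ⟨?_, hne⟩
    have hsq : normSq w < 1 := by
      rw [Complex.normSq_eq_norm_sq]
      nlinarith [norm_nonneg w]
    have hp : 0 < normSq (1 - w) := normSq_pos.2 hne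
    have : (I * (1 + w) / (1 - w)).im = (1 - normSq w) / normSq (1 - w) := by
      rw [Complex.div_im, ← sub_div]
      congr 1
      rw [normSq_apply]
      simp
      ring
    rw [this]
    exact div_pos (by linarith) hp
  obtain ⟨μ, hμ, hP⟩ := nev_disc (fun w => -I * f (I * (1 + w) / (1 - w)))
    (by
      refine DifferentiableOn.const_mul ?_ _
      refine hf.1.comp ?_ fun w hw => (hmap w (by simpa using hw)).1
      intro w hw
      have := (hmap w (by simpa using hw)).2
      exact DifferentiableAt.differentiableWithinAt (by fun_prop (disch := assumption)))
    (by
      intro w hw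
      have := hf.2 _ (hmap w hw).1
      simpa using this)
  let S : Set ℝ := {θ | circleMap 0 1 θ = 1}
  have hS : MeasurableSet S := (isClosed_eq (continuous_circleMap 0 1) continuous_const).measurableSet
  let d : ℝ → ENNReal := fun ξ => ENNReal.ofReal (1 + ξ ^ 2)
  have hd : Measurable d := by fun_prop
  have hdr : ∀ ξ : ℝ, (d ξ).toReal = 1 + ξ ^ 2 := fun ξ => ENNReal.toReal_ofReal (by positivity)
  have hdt : ∀ (κ : Measure ℝ), ∀ᵐ ξ ∂κ, d ξ < ⊤ := fun κ => ae_of_all _ fun ξ => by simp [d]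
  let κ : Measure ℝ := (μ.restrict Sᶜ).map nevXi
  have hκ : IsFiniteMeasure κ := Measure.isFiniteMeasure_map _ _
  let ν : Measure ℝ := κ.withDensity d
  have hν : Integrable (fun ξ : ℝ => (1 + ξ ^ 2)⁻¹) ν := by
    rw [integrable_withDensity_iff_integrable_smul' hd (hdt _)]
    have : (fun ξ : ℝ => (d ξ).toReal • (1 + ξ ^ 2)⁻¹) = fun _ => (1 : ℝ) := by
      ext ξ
      rw [hdr, smul_eq_mul, mul_inv_cancel₀ (by positivity)]
    rw [this]
    exact integrable_const _
  let α : ℝ := μ.real S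
  obtain ⟨β, hβ⟩ := nev_uniq_const f (fun ω => (α : ℂ) * ω + ∫ ξ : ℝ, nevK ξ ω ∂ν) hf.1
    (DifferentiableOn.add (by fun_prop) (nevK_diff hν)) (by
      intro ω h
      obtain ⟨h1, h2, h3⟩ := nev_w h
      have hp := hP _ h2
      rw [h3] at hp
      have hl : (-I * f ω).re = (f ω).im := by simp
      rw [hl] at hp
      have hb := nev_poisson_bcf h2
      have hi : Integrable (fun θ : ℝ => poissonKernel 0 ((ω - I) / (ω + I)) (circleMap 0 1 θ)) μ :=
        (integrable_const _).mono' hb.1.aestronglyMeasurable (ae_of_all _ hb.2)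
      rw [hp, ← integral_add_compl hS hi]
      simp only [add_im]
      rw [nevK_int_im hν h]
      congr 1
      · rw [setIntegral_congr_fun (g := fun _ => ω.im) hS (fun θ hθ => by
          have : circleMap 0 1 θ = 1 := hθ
          simp only [this, nev_kernel_one h])]
        simp [α]
      · rw [setIntegral_congr_fun
          (g := fun θ => (1 + nevXi θ ^ 2) * (nevK (nevXi θ) ω).im) hS.compl
          (fun θ hθ => nev_kernel_compl h hθ)]
        simp only [ν]
        rw [integral_withDensity_eq_integral_toReal_smul hd (hdt _)]
        simp only [κ, hdr, smul_eq_mul]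
        rw [integral_map nevXi_meas.aemeasurable]
        have := measurable_im.comp (nevK_meas ω)
        have h5 : Measurable (fun ξ : ℝ => (nevK ξ ω).im) := this
        exact Measurable.aestronglyMeasurable (by fun_prop))
  refine ⟨α, β, ν, measureReal_nonneg, hν, fun ω h => ?_⟩
  rw [hβ ω h]
  ring


/-- Nevanlinna's representation theorem: `f` is a Herglotz function iff there exist `α ≥ 0`,
`β ∈ ℝ` and a positive Borel measure `ν` on `ℝ` with `∫ dν(ξ)/(1+ξ²) < ∞` such that
`f(ω) = α ω + β + ∫ (1/(ξ-ω) - ξ/(1+ξ²)) dν(ξ)` on `ℂ⁺`. Moreover, in any such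
representation, `α = lim_{y→+∞} f(iy)/(iy)` and `β = Re f(i)`. -/
theorem nevanlinna_representation (f : ℂ → ℂ) :
    (IsHerglotz f ↔
      ∃ (α β : ℝ) (ν : Measure ℝ), 0 ≤ α ∧
        Integrable (fun ξ : ℝ => (1 + ξ ^ 2)⁻¹) ν ∧
        ∀ ω : ℂ, 0 < ω.im →
          f ω = (α : ℂ) * ω + (β : ℂ)
            + ∫ ξ : ℝ, (((ξ : ℂ) - ω)⁻¹ - (ξ : ℂ) / (1 + (ξ : ℂ) ^ 2)) ∂ν) ∧
    (∀ (α β : ℝ) (ν : Measure ℝ), 0 ≤ α →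
      Integrable (fun ξ : ℝ => (1 + ξ ^ 2)⁻¹) ν →
      (∀ ω : ℂ, 0 < ω.im →
        f ω = (α : ℂ) * ω + (β : ℂ)
          + ∫ ξ : ℝ, (((ξ : ℂ) - ω)⁻¹ - (ξ : ℂ) / (1 + (ξ : ℂ) ^ 2)) ∂ν) →
      Tendsto (fun y : ℝ => f (Complex.I * (y : ℂ)) / (Complex.I * (y : ℂ)))
          atTop (nhds (α : ℂ)) ∧
        β = (f Complex.I).re) := by
  exact ⟨⟨nev_forward f, fun ⟨α, β, ν, hα, hν, h⟩ => nev_converse f α β ν hα hν h⟩,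
    fun α β ν _ hν h => nev_moreover f α β ν hν h⟩
end

section
/- Let ε₀ > 0 and let ε : ℂ⁺ → ℂ be such that ω ↦ ω ε(ω)/ε₀ is a Herglotz function, ε satisfies the reality principle ε(−conj(ω)) = conj(ε(ω)) for all ω ∈ ℂ⁺, and ε(iy) → ε₀ as y → +∞. Then there exists a positive Borel measure ν_e on ℝ, symmetric (ν_e(−B) = ν_e(B) for every Borel set B) and satisfying ∫_ℝ dν_e(ξ)/(1+ξ²) < ∞, such that ε(ω) = ε₀ (1 + ∫_ℝ dν_e(ξ)/(ξ² − ω²)) for every ω ∈ ℂ⁺. -/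
open Complex MeasureTheory Filter

lemma schwarz_aux {F : ℂ → ℂ} (hF : DiffContOnCl ℂ F (Metric.ball 0 1)) {w : ℂ}
    (hw : w ∈ Metric.ball (0:ℂ) 1) :
    Real.circleAverage (fun ζ => herglotzRieszKernel 0 w ζ * ((F ζ).re : ℂ)) 0 1
      = F w - I * ((F 0).im : ℂ) := by
  have hF' : DiffContOnCl ℂ F (Metric.ball 0 |1|) := by simpa using hF
  have hw' : w ∈ Metric.ball (0:ℂ) |1| := by simpa using hw
  have P := hF.circleAverage_re_herglotzRieszKernel_smul hw
  have C := hF'.circleAverage_smul_div hw'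
  have M := hF'.circleAverage
  have hFc : ContinuousOn F (Metric.sphere 0 1) :=
    hF.2.mono <| Metric.sphere_subset_closedBall.trans_eq (closure_ball 0 one_ne_zero).symm
  have hHc : ContinuousOn (herglotzRieszKernel 0 w) (Metric.sphere 0 1) := by
    simpa using continuousOn_herglotzRieszKernel_sphere hw
  have hne : ∀ z ∈ Metric.sphere (0:ℂ) 1, z - w ≠ 0 := by
    intro z hz h
    rw [sub_eq_zero] at h
    subst h
    simp at hz hw
    linarith
  have cint : ∀ {g : ℂ → ℂ}, ContinuousOn g (Metric.sphere 0 1) → CircleIntegrable g 0 1 :=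
    fun h => h.circleIntegrable zero_le_one
  have hcc : ContinuousOn (fun z : ℂ => (z - 0) / (z - w)) (Metric.sphere 0 1) :=
    ContinuousOn.div (by fun_prop) (by fun_prop) hne
  have Q : Real.circleAverage (fun ζ => herglotzRieszKernel 0 w ζ * F ζ) 0 1 = 2 * F w - F 0 := by
    have : Real.circleAverage (fun ζ => (2:ℂ) • (((ζ - 0) / (ζ - w)) • F ζ) - F ζ) 0 1
        = 2 * F w - F 0 := by
      rw [Real.circleAverage_fun_sub (cint (by fun_prop)) (cint hFc), Real.circleAverage_fun_smul, C, M,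
        smul_eq_mul]
    rw [← this]
    apply Real.circleAverage_congr_sphere
    intro z hz
    have := hne z (by simpa using hz)
    simp only [herglotzRieszKernel_def, smul_eq_mul, sub_zero]
    field_simp
    ring
  have R : Real.circleAverage (fun ζ => (starRingEnd ℂ) (herglotzRieszKernel 0 w ζ) * F ζ) 0 1 = F 0 := by
    have : Real.circleAverage (fun ζ => (2:ℂ) • (((re ∘ herglotzRieszKernel 0 w) • F) ζ)
        - herglotzRieszKernel 0 w ζ * F ζ) 0 1 = F 0 := by
      rw [Real.circleAverage_fun_sub _ (cint (by fun_prop)), Real.circleAverage_fun_smul, P, Q,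
        smul_eq_mul]
      · ring
      · apply cint
        exact ContinuousOn.const_smul
          (ContinuousOn.smul (Complex.continuous_re.comp_continuousOn hHc) hFc) (2:ℂ)
    rw [← this]
    apply Real.circleAverage_congr_sphere
    intro z hz
    simp only [Pi.smul_apply', Function.comp, real_smul, smul_eq_mul]
    have : (starRingEnd ℂ) (herglotzRieszKernel 0 w z) =
      2 * ((herglotzRieszKernel 0 w z).re : ℂ) - herglotzRieszKernel 0 w z := by
      apply Complex.ext <;> simp; ring
    rw [this]; ring
  have R' : Real.circleAverage (fun ζ => (herglotzRieszKernel 0 w ζ) * (starRingEnd ℂ) (F ζ)) 0 1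
      = (starRingEnd ℂ) (F 0) := by
    have := (conjCLE : ℂ →L[ℝ] ℂ).circleAverage_comp_comm (c := 0) (R := 1)
      (f := (fun ζ => (starRingEnd ℂ) (herglotzRieszKernel 0 w ζ) * F ζ))
      (cint ((Complex.continuous_conj.comp_continuousOn hHc).mul hFc))
    rw [R] at this
    simpa [Function.comp_def] using this
  have : Real.circleAverage (fun ζ => (2:ℂ)⁻¹ • (herglotzRieszKernel 0 w ζ * F ζ +
      (herglotzRieszKernel 0 w ζ) * (starRingEnd ℂ) (F ζ))) 0 1 = F w - I * ((F 0).im : ℂ) := by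
    have i1 : CircleIntegrable (fun ζ => herglotzRieszKernel 0 w ζ * F ζ) 0 1 := cint (hHc.mul hFc)
    have i2 : CircleIntegrable (fun ζ => herglotzRieszKernel 0 w ζ * (starRingEnd ℂ) (F ζ)) 0 1 :=
      cint (hHc.mul (Complex.continuous_conj.comp_continuousOn hFc))
    rw [Real.circleAverage_fun_smul, Real.circleAverage_fun_add i1 i2, Q, R']
    apply Complex.ext <;> simp <;> ring
  rw [← this]
  congr 1
  ext z
  have : (F z).re = (2:ℂ)⁻¹ * (F z + (starRingEnd ℂ) (F z)) := by
    apply Complex.ext <;> simp; ring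
  rw [this, smul_eq_mul]; ring

lemma disc_rep {F : ℂ → ℂ} (hF : DifferentiableOn ℂ F (Metric.ball 0 1))
    (hpos : ∀ w ∈ Metric.ball (0:ℂ) 1, 0 ≤ (F w).re) :
    ∃ μ : FiniteMeasure ℝ, ∀ w ∈ Metric.ball (0:ℂ) 1,
      F w = I * ((F 0).im : ℂ) +
        ∫ θ, herglotzRieszKernel 0 w (circleMap 0 1 θ) ∂(μ : Measure ℝ) := by
  have hmaps : ∀ r : ℝ, r ∈ Set.Ioo (0:ℝ) 1 → ∀ z ∈ Metric.closedBall (0:ℂ) 1,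
      (r:ℂ) * z ∈ Metric.ball (0:ℂ) 1 := by
    intro r hr z hz
    simp only [mem_closedBall_zero_iff, mem_ball_zero_iff, norm_mul, norm_real, Real.norm_eq_abs,
      abs_of_pos hr.1] at *
    nlinarith [hr.1, hr.2, norm_nonneg z]
  have hFr : ∀ r : ℝ, r ∈ Set.Ioo (0:ℝ) 1 → DiffContOnCl ℂ (fun z => F (r * z)) (Metric.ball 0 1) := by
    intro r hr
    apply DifferentiableOn.diffContOnCl
    rw [closure_ball 0 one_ne_zero]
    exact hF.comp (by fun_prop) (hmaps r hr)
  let d : ℝ → ℝ → NNReal := fun r θ => Real.toNNReal ((2 * Real.pi)⁻¹ * (F (r * circleMap 0 1 θ)).re)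
  have hcm : ∀ θ, circleMap 0 1 θ ∈ Metric.closedBall (0:ℂ) 1 := by
    intro θ; simp
  have hdc : ∀ r : ℝ, r ∈ Set.Ioo (0:ℝ) 1 → Continuous (d r) := by
    intro r hr
    apply continuous_real_toNNReal.comp
    apply continuous_const.mul
    apply Complex.continuous_re.comp
    exact hF.continuousOn.comp_continuous (by fun_prop) (fun θ => hmaps r hr _ (hcm θ))
  have hdv : ∀ r : ℝ, r ∈ Set.Ioo (0:ℝ) 1 → ∀ θ,
      ((d r θ : ℝ)) = (2 * Real.pi)⁻¹ * (F (r * circleMap 0 1 θ)).re := by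
    intro r hr θ
    apply Real.coe_toNNReal
    have := hpos _ (hmaps r hr _ (hcm θ))
    positivity
  let M : ℝ → Measure ℝ := fun r =>
    (volume.restrict (Set.Ioc 0 (2 * Real.pi))).withDensity (fun θ => (d r θ : ENNReal))
  have hMint : ∀ r : ℝ, r ∈ Set.Ioo (0:ℝ) 1 → ∀ w ∈ Metric.ball (0:ℂ) 1,
      ∫ θ, herglotzRieszKernel 0 w (circleMap 0 1 θ) ∂(M r) = F (r * w) - I * ((F 0).im : ℂ) := by
    intro r hr w hw
    have := schwarz_aux (hFr r hr) hw
    simp only [mul_zero] at this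
    rw [← this, integral_withDensity_eq_integral_smul (hdc r hr).measurable, Real.circleAverage_def,
      intervalIntegral.integral_of_le (by positivity), ← integral_smul]
    congr 1
    ext θ
    rw [NNReal.smul_def, hdv r hr, real_smul, real_smul]
    push_cast
    ring
  have hMmass : ∀ r : ℝ, r ∈ Set.Ioo (0:ℝ) 1 → M r Set.univ = ENNReal.ofReal (F 0).re := by
    intro r hr
    have h0 := (hFr r hr)
    have h1 : DiffContOnCl ℂ (fun z => F (r * z)) (Metric.ball 0 |1|) := by simpa using h0
    have h2 := h1.circleAverage
    have h3 : ContinuousOn (fun z => F (r * z)) (Metric.sphere 0 1) :=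
      h0.2.mono <| Metric.sphere_subset_closedBall.trans_eq (closure_ball 0 one_ne_zero).symm
    have h4 := Complex.reCLM.circleAverage_comp_comm (h3.circleIntegrable zero_le_one)
    rw [h2] at h4
    simp only [mul_zero, reCLM_apply] at h4
    rw [← h4, Real.circleAverage_def, intervalIntegral.integral_of_le (by positivity),
      ← integral_smul, withDensity_apply _ MeasurableSet.univ, Measure.restrict_univ,
      ofReal_integral_eq_lintegral_ofReal]
    · congr 1
    · apply IntegrableOn.mono_set (t := Set.Icc 0 (2 * Real.pi)) _ Set.Ioc_subset_Icc_self
      apply Continuous.integrableOn_Icc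
      have := NNReal.continuous_coe.comp (hdc r hr)
      refine this.congr (fun θ => ?_)
      simp only [Function.comp, hdv r hr]
      simp
    · refine Eventually.of_forall (fun θ => ?_)
      have := hpos _ (hmaps r hr _ (hcm θ))
      simp only [Function.comp, reCLM_apply, smul_eq_mul, Pi.zero_apply]
      positivity
  have hfin : ∀ r : ℝ, r ∈ Set.Ioo (0:ℝ) 1 → IsFiniteMeasure (M r) := by
    intro r hr
    exact ⟨by rw [hMmass r hr]; exact ENNReal.ofReal_lt_top⟩
  classical
  let MF : ℝ → FiniteMeasure ℝ := fun r =>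
    if h : r ∈ Set.Ioo (0:ℝ) 1 then ⟨M r, hfin r h⟩ else 0
  have hMF : ∀ r : ℝ, r ∈ Set.Ioo (0:ℝ) 1 → (MF r : Measure ℝ) = M r := by
    intro r hr; simp [MF, hr]
  have hcomp := isCompact_setOfPred_finiteMeasure_le_of_isCompact (E := ℝ)
    (Real.toNNReal (F 0).re) (isCompact_Icc (a := (0:ℝ)) (b := 2 * Real.pi))
  have : (nhdsWithin (1:ℝ) (Set.Iio 1)).NeBot := inferInstance
  let U : Ultrafilter ℝ := Ultrafilter.of (nhdsWithin (1:ℝ) (Set.Iio 1))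
  have hU : (U : Filter ℝ) ≤ nhdsWithin (1:ℝ) (Set.Iio 1) := Ultrafilter.of_le _
  have hUI : ∀ᶠ r in (U : Filter ℝ), r ∈ Set.Ioo (0:ℝ) 1 :=
    hU (Ioo_mem_nhdsLT (by norm_num))
  obtain ⟨μ, -, hμ⟩ := isCompact_iff_ultrafilter_le_nhds'.1 hcomp (U.map MF) (by
    rw [Ultrafilter.mem_map]
    filter_upwards [hUI] with r hr
    constructor
    · rw [← ENNReal.coe_le_coe, FiniteMeasure.ennreal_mass, hMF r hr, hMmass r hr]
      rfl
    · have : (MF r : Measure ℝ) (Set.Icc 0 (2 * Real.pi))ᶜ = 0 := by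
        rw [hMF r hr]
        apply withDensity_absolutelyContinuous
        rw [Measure.restrict_apply measurableSet_Icc.compl]
        convert measure_empty (μ := (volume : Measure ℝ))
        ext x
        simp only [Set.mem_inter_iff, Set.mem_compl_iff, Set.mem_Icc, Set.mem_Ioc,
          Set.mem_empty_iff_false, iff_false]
        rintro ⟨h1, h2⟩
        exact h1 ⟨h2.1.le, h2.2⟩
      exact (FiniteMeasure.null_iff_toMeasure_null _ _).2 this)
  refine ⟨μ, fun w hw => ?_⟩
  have hT : Tendsto MF U (nhds μ) := hμ
  have hne : ∀ θ, circleMap 0 1 θ - w ≠ 0 := fun θ => sub_ne_zero.2 (circleMap_ne_mem_ball hw θ)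
  have hkc : Continuous (fun θ => herglotzRieszKernel 0 w (circleMap 0 1 θ)) := by
    simp only [herglotzRieszKernel_def, sub_zero]
    exact Continuous.div (by fun_prop) (by fun_prop) hne
  have hw1 : ‖w‖ < 1 := by simpa using hw
  let k : BoundedContinuousFunction ℝ ℂ := BoundedContinuousFunction.ofNormedAddCommGroup _ hkc
    (2 / (1 - ‖w‖)) (by
      intro θ
      simp only [herglotzRieszKernel_def, sub_zero, norm_div]
      have e1 : ‖circleMap 0 1 θ‖ = 1 := by simp
      have : 1 - ‖w‖ ≤ ‖circleMap 0 1 θ - w‖ := by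
        have := norm_sub_norm_le (circleMap 0 1 θ) w
        rwa [e1] at this
      have h2 : ‖circleMap 0 1 θ + w‖ ≤ 2 := by
        have := norm_add_le (circleMap 0 1 θ) w
        rw [e1] at this; linarith
      gcongr)
  have hlim := (FiniteMeasure.tendsto_iff_forall_integral_rclike_tendsto ℂ).1 hT k
  have hlim2 : Tendsto (fun r : ℝ => F (r * w) - I * ((F 0).im : ℂ)) U
      (nhds (∫ θ, herglotzRieszKernel 0 w (circleMap 0 1 θ) ∂(μ : Measure ℝ))) := by
    refine Tendsto.congr' ?_ hlim
    filter_upwards [hUI] with r hr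
    rw [hMF r hr, ← hMint r hr w hw]
    rfl
  have hlim3 : Tendsto (fun r : ℝ => F (r * w) - I * ((F 0).im : ℂ)) U
      (nhds (F w - I * ((F 0).im : ℂ))) := by
    apply Tendsto.sub_const
    have hc : ContinuousAt F w := (hF.differentiableAt (Metric.isOpen_ball.mem_nhds hw)).continuousAt
    apply hc.tendsto.comp
    have : Tendsto (fun r : ℝ => (r:ℂ) * w) (nhds 1) (nhds ((1:ℝ) * w)) :=
      Continuous.tendsto (by fun_prop) _
    simp only [ofReal_one, one_mul] at this
    exact this.mono_left (hU.trans nhdsWithin_le_nhds)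
  have := tendsto_nhds_unique hlim2 hlim3
  rw [this]; ring


lemma kernel_bdd {w : ℂ} (hw : w ∈ Metric.ball (0:ℂ) 1) (μ : Measure ℝ) [IsFiniteMeasure μ] :
    Integrable (fun θ => herglotzRieszKernel 0 w (circleMap 0 1 θ)) μ := by
  have hne : ∀ θ, circleMap 0 1 θ - w ≠ 0 := fun θ => sub_ne_zero.2 (circleMap_ne_mem_ball hw θ)
  have hkc : Continuous (fun θ => herglotzRieszKernel 0 w (circleMap 0 1 θ)) := by
    simp only [herglotzRieszKernel_def, sub_zero]
    exact Continuous.div (by fun_prop) (by fun_prop) hne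
  have hw1 : ‖w‖ < 1 := by simpa using hw
  refine Integrable.of_bound hkc.aestronglyMeasurable (2 / (1 - ‖w‖)) (Eventually.of_forall ?_)
  intro θ
  simp only [herglotzRieszKernel_def, sub_zero, norm_div]
  have e1 : ‖circleMap 0 1 θ‖ = 1 := by simp
  have : 1 - ‖w‖ ≤ ‖circleMap 0 1 θ - w‖ := by
    have := norm_sub_norm_le (circleMap 0 1 θ) w
    rwa [e1] at this
  have h2 : ‖circleMap 0 1 θ + w‖ ≤ 2 := by
    have := norm_add_le (circleMap 0 1 θ) w
    rw [e1] at this; linarith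
  gcongr

lemma add_I_ne {z : ℂ} (hz : 0 < z.im) : z + I ≠ 0 := by
  intro h
  have := congrArg Complex.im h
  simp at this; linarith

lemma real_add_I_ne (t : ℝ) : (t:ℂ) + I ≠ 0 := by
  intro h
  have := congrArg Complex.im h
  simp at this

lemma real_sub_ne (t : ℝ) {z : ℂ} (hz : 0 < z.im) : (t:ℂ) - z ≠ 0 := by
  intro h
  have := congrArg Complex.im h
  simp at this; linarith

lemma kernel_real (t : ℝ) {z : ℂ} (hz : 0 < z.im) :
    I * herglotzRieszKernel 0 ((z - I) / (z + I)) (((t:ℂ) - I) / (t + I)) = (1 + t * z) / (t - z) := by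
  have h1 := add_I_ne hz
  have h2 := real_add_I_ne t
  have h3 := real_sub_ne t hz
  have e1 : ((t:ℂ) - I) / (t + I) + (z - I) / (z + I) = 2 * (1 + t * z) / ((t + I) * (z + I)) := by
    field_simp
    linear_combination (-2) * I_sq
  have e2 : ((t:ℂ) - I) / (t + I) - (z - I) / (z + I) = 2 * I * (t - z) / ((t + I) * (z + I)) := by
    field_simp
    ring
  rw [herglotzRieszKernel_def]
  simp only [sub_zero]
  rw [e1, e2]
  have := I_ne_zero
  field_simp

lemma kernel_one {z : ℂ} (hz : 0 < z.im) :
    I * herglotzRieszKernel 0 ((z - I) / (z + I)) 1 = z := by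
  have h1 := add_I_ne hz
  have e1 : 1 + (z - I) / (z + I) = 2 * z / (z + I) := by field_simp; ring
  have e2 : 1 - (z - I) / (z + I) = 2 * I / (z + I) := by field_simp; ring
  rw [herglotzRieszKernel_def]
  simp only [sub_zero]
  rw [e1, e2]
  have := I_ne_zero
  field_simp

lemma cayley_mem {z : ℂ} (hz : 0 < z.im) : (z - I) / (z + I) ∈ Metric.ball (0:ℂ) 1 := by
  have h1 := add_I_ne hz
  rw [mem_ball_zero_iff, norm_div, div_lt_one (by positivity)]
  rw [← sq_lt_sq₀ (by positivity) (by positivity), Complex.sq_norm, Complex.sq_norm, normSq_apply,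
    normSq_apply]
  simp
  nlinarith

lemma cayley_inv_im {w : ℂ} (hw : w ∈ Metric.ball (0:ℂ) 1) : 0 < (I * ((1 + w) / (1 - w))).im := by
  have h := congrFun (poissonKernel_eq_re_herglotzRieszKernel (c := 0) (w := w)) 1
  simp [poissonKernel_def, herglotzRieszKernel_def] at h
  have hw1 : ‖w‖ < 1 := by simpa using hw
  have hne : (1:ℂ) - w ≠ 0 := by
    intro h
    rw [sub_eq_zero] at h
    rw [← h] at hw1; simp at hw1
  simp only [I_mul_im]
  rw [← h]
  have : 0 < 1 - ‖w‖^2 := by nlinarith [norm_nonneg w]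
  positivity

lemma cayley_real {ζ : ℂ} (h : ‖ζ‖ = 1) (h1 : ζ ≠ 1) :
    ζ = (((I * ((1 + ζ) / (1 - ζ))).re : ℂ) - I) / (((I * ((1 + ζ) / (1 - ζ))).re : ℂ) + I) := by
  have h0 : ζ ≠ 0 := by rintro rfl; simp at h
  have hne : 1 - ζ ≠ 0 := sub_ne_zero.2 (Ne.symm h1)
  have hne' : ζ - 1 ≠ 0 := sub_ne_zero.2 h1
  have e : ((I * ((1 + ζ) / (1 - ζ))).re : ℂ) = I * ((1 + ζ) / (1 - ζ)) := by
    apply Complex.conj_eq_iff_re.1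
    have : (starRingEnd ℂ) ζ = ζ⁻¹ := (Complex.inv_eq_conj h).symm
    simp only [map_mul, conj_I, map_div₀, map_add, map_sub, map_one, this]
    field_simp
    have e1 : (1 + ζ) / (ζ - 1) = - ((1 + ζ) / (1 - ζ)) := by
      rw [← neg_sub 1 ζ, div_neg]
    grind
  rw [eq_div_iff (real_add_I_ne _), e]
  field_simp
  ring

lemma conj_kernel (w ζ : ℂ) : (starRingEnd ℂ) (herglotzRieszKernel 0 ((starRingEnd ℂ) w) ζ)
    = herglotzRieszKernel 0 w ((starRingEnd ℂ) ζ) := by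
  simp [herglotzRieszKernel_def]

lemma conj_cayley (t : ℝ) : (starRingEnd ℂ) (((t:ℂ) - I) / (t + I)) =
    (((-t : ℝ) : ℂ) - I) / (((-t : ℝ) : ℂ) + I) := by
  simp only [map_div₀, map_sub, map_add, conj_ofReal, conj_I, ofReal_neg]
  rw [← neg_div_neg_eq]
  ring

lemma sym_kernel {ζ : ℂ} (h : ‖ζ‖ = 1) (h1 : ζ ≠ 1) {z : ℂ} (hz : 0 < z.im) :
    I / 2 * (herglotzRieszKernel 0 ((z - I) / (z + I)) ζ +
      herglotzRieszKernel 0 ((z - I) / (z + I)) ((starRingEnd ℂ) ζ)) =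
    z * ((1 + ((I * ((1 + ζ) / (1 - ζ))).re : ℂ) ^ 2) /
      (((I * ((1 + ζ) / (1 - ζ))).re : ℂ) ^ 2 - z ^ 2)) := by
  have e := cayley_real h h1
  set t : ℝ := (I * ((1 + ζ) / (1 - ζ))).re
  rw [e, conj_cayley]
  have k1 := kernel_real t hz
  have k2 := kernel_real (-t) hz
  have n1 := real_sub_ne t hz
  have n2 := real_sub_ne (-t) hz
  have n3 : (t:ℂ)^2 - z^2 ≠ 0 := by
    have : (t:ℂ)^2 - z^2 = -((t - z) * (((-t:ℝ):ℂ) - z)) := by push_cast; ring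
    rw [this]
    exact neg_ne_zero.2 (mul_ne_zero n1 n2)
  calc _ = 1 / 2 * (I * herglotzRieszKernel 0 ((z - I) / (z + I)) (((t:ℂ) - I) / (t + I)) +
        I * herglotzRieszKernel 0 ((z - I) / (z + I)) ((((-t : ℝ) : ℂ) - I) / (((-t : ℝ) : ℂ) + I))) := by ring
    _ = _ := by
      rw [k1, k2]
      push_cast at *
      field_simp
      ring

lemma ker_bound {z : ℂ} (hz : 0 < z.im) (t : ℝ) :
    ‖((t:ℂ)^2 - z^2)⁻¹‖ ≤ (z.im ^ 2)⁻¹ := by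
  rw [norm_inv]
  gcongr
  have : (t:ℂ)^2 - z^2 = (t - z) * (t + z) := by ring
  rw [this, norm_mul, sq]
  have a1 := Complex.abs_im_le_norm ((t:ℂ) - z)
  have a2 := Complex.abs_im_le_norm ((t:ℂ) + z)
  simp [abs_of_pos hz] at a1 a2
  gcongr

lemma ker_ne {z : ℂ} (hz : 0 < z.im) (t : ℝ) : (t:ℂ)^2 - z^2 ≠ 0 := by
  have n1 := real_sub_ne t hz
  have n2 := real_sub_ne (-t) hz
  have : (t:ℂ)^2 - z^2 = -((t - z) * (((-t:ℝ):ℂ) - z)) := by push_cast; ring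
  rw [this]
  exact neg_ne_zero.2 (mul_ne_zero n1 n2)

lemma ker_cont {z : ℂ} (hz : 0 < z.im) : Continuous (fun t : ℝ => (1 + (t:ℂ)^2) / ((t:ℂ)^2 - z^2)) :=
  Continuous.div (by fun_prop) (by fun_prop) (ker_ne hz)

lemma ker_integrable {z : ℂ} (hz : 0 < z.im) (ρ : Measure ℝ) [IsFiniteMeasure ρ] :
    Integrable (fun t : ℝ => (1 + (t:ℂ)^2) / ((t:ℂ)^2 - z^2)) ρ := by
  refine Integrable.of_bound (ker_cont hz).aestronglyMeasurable
    (1 + ‖1 + z^2‖ * (z.im ^ 2)⁻¹) (Eventually.of_forall fun t => ?_)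
  have : (1 + (t:ℂ)^2) / ((t:ℂ)^2 - z^2) = 1 + (1 + z^2) * ((t:ℂ)^2 - z^2)⁻¹ := by
    have := ker_ne hz t
    field_simp
    ring
  rw [this]
  refine (norm_add_le _ _).trans ?_
  rw [norm_mul, norm_one]
  gcongr
  exact ker_bound hz t

lemma half_plane_rep {f : ℂ → ℂ} (hf : IsHerglotz f)
    (hsym : ∀ z : ℂ, 0 < z.im → f (-(starRingEnd ℂ z)) = -(starRingEnd ℂ (f z))) :
    ∃ (a : ℝ) (ρ : Measure ℝ), IsFiniteMeasure ρ ∧ ∀ z : ℂ, 0 < z.im →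
      f z = z * (a + ∫ t : ℝ, (1 + (t:ℂ)^2) / ((t:ℂ)^2 - z^2) ∂ρ) := by
  let F : ℂ → ℂ := fun w => -I * f (I * ((1 + w) / (1 - w)))
  have hFd : DifferentiableOn ℂ F (Metric.ball 0 1) := by
    have hne : ∀ w ∈ Metric.ball (0:ℂ) 1, 1 - w ≠ 0 := by
      intro w hw h
      rw [sub_eq_zero] at h
      rw [← h] at hw; simp at hw
    apply DifferentiableOn.const_mul
    refine hf.1.comp (t := {z : ℂ | 0 < z.im}) ?_ (fun w hw => cayley_inv_im hw)
    exact DifferentiableOn.const_mul (DifferentiableOn.div (by fun_prop) (by fun_prop) hne) _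
  have hFp : ∀ w ∈ Metric.ball (0:ℂ) 1, 0 ≤ (F w).re := by
    intro w hw
    have := hf.2 _ (cayley_inv_im hw)
    simpa [F] using this
  obtain ⟨μ, hμ⟩ := disc_rep hFd hFp
  set c : ℝ := (F 0).im with hc
  let A : Set ℝ := {θ | circleMap 0 1 θ = 1}
  have hA : MeasurableSet A := (isClosed_eq (by fun_prop) continuous_const).measurableSet
  let T : ℝ → ℝ := fun θ => (I * ((1 + circleMap 0 1 θ) / (1 - circleMap 0 1 θ))).re
  have hcm : Measurable (circleMap 0 1) := (continuous_circleMap 0 1).measurable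
  have hT : Measurable T := by
    apply Complex.measurable_re.comp
    exact ((hcm.const_add 1).div (hcm.const_sub 1)).const_mul I
  have hfz : ∀ z : ℂ, 0 < z.im → f z = -c + I * ∫ θ, herglotzRieszKernel 0 ((z - I) / (z + I))
      (circleMap 0 1 θ) ∂(μ : Measure ℝ) := by
    intro z hz
    have h := hμ _ (cayley_mem hz)
    have hi : I * ((1 + (z - I) / (z + I)) / (1 - (z - I) / (z + I))) = z := by
      simpa [herglotzRieszKernel_def] using kernel_one hz
    have hF : F ((z - I) / (z + I)) = -I * f z := by
      simp only [F]; rw [hi]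
    rw [hF] at h
    linear_combination I * h + (f z + c) * I_sq
  refine ⟨(μ : Measure ℝ).real A, ((μ : Measure ℝ).restrict Aᶜ).map T, ?_, ?_⟩
  · exact Measure.isFiniteMeasure_map _ _
  intro z hz
  have hz' : 0 < (-(starRingEnd ℂ z)).im := by simpa using hz
  have h1 := hfz z hz
  have h2 := hfz _ hz'
  have hwc : (-(starRingEnd ℂ z) - I) / (-(starRingEnd ℂ z) + I) =
      (starRingEnd ℂ) ((z - I) / (z + I)) := by
    simp only [map_div₀, map_sub, map_add, conj_I]
    rw [← neg_div_neg_eq]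
    ring
  have hw := cayley_mem hz
  have hw' := cayley_mem hz'
  rw [hwc] at h2 hw'
  set w := (z - I) / (z + I)
  have h3 : f z = c + I * ∫ θ, herglotzRieszKernel 0 w ((starRingEnd ℂ) (circleMap 0 1 θ)) ∂(μ : Measure ℝ) := by
    simp_rw [← conj_kernel, integral_conj]
    rw [hsym z hz] at h2
    have h4 := congrArg (starRingEnd ℂ) h2
    simp only [map_neg, map_add, map_mul, conj_I, conj_ofReal, Complex.conj_conj] at h4
    linear_combination -h4
  have i1 := kernel_bdd hw (μ : Measure ℝ)
  have i2 : Integrable (fun θ => herglotzRieszKernel 0 w ((starRingEnd ℂ) (circleMap 0 1 θ))) (μ : Measure ℝ) := by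
    simp_rw [← conj_kernel]
    exact (conjCLE : ℂ →L[ℝ] ℂ).integrable_comp (kernel_bdd hw' (μ : Measure ℝ))
  have h5 : f z = ∫ θ, I / 2 * (herglotzRieszKernel 0 w (circleMap 0 1 θ) +
      herglotzRieszKernel 0 w ((starRingEnd ℂ) (circleMap 0 1 θ))) ∂(μ : Measure ℝ) := by
    rw [integral_const_mul, integral_add i1 i2]
    linear_combination (h1 + h3) / 2
  have i3 : Integrable (fun θ => I / 2 * (herglotzRieszKernel 0 w (circleMap 0 1 θ) +
      herglotzRieszKernel 0 w ((starRingEnd ℂ) (circleMap 0 1 θ)))) (μ : Measure ℝ) :=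
    (i1.add i2).const_mul (I / 2)
  rw [h5, ← integral_add_compl hA i3, mul_add]
  congr 1
  · rw [setIntegral_congr_fun (g := fun _ => z) hA]
    · rw [setIntegral_const, real_smul, mul_comm]
    · intro θ hθ
      have hθ' : circleMap 0 1 θ = 1 := hθ
      have := kernel_one hz
      simp only [hθ', map_one]
      linear_combination this
  · rw [integral_map hT.aemeasurable (ker_cont hz).aestronglyMeasurable, ← integral_const_mul]
    apply setIntegral_congr_fun hA.compl
    intro θ hθ
    exact sym_kernel (by simp) hθ hz

lemma lim_zero (ρ : Measure ℝ) [IsFiniteMeasure ρ] :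
    Tendsto (fun y : ℝ => ∫ t : ℝ, (1 + (t:ℂ)^2) / ((t:ℂ)^2 - (I * (y:ℂ))^2) ∂ρ) atTop (nhds 0) := by
  have e : ∀ t y : ℝ, (1 + (t:ℂ)^2) / ((t:ℂ)^2 - (I * (y:ℂ))^2) = (((1 + t^2) / (t^2 + y^2) : ℝ) : ℂ) := by
    intro t y
    push_cast
    rw [mul_pow, I_sq]
    ring
  simp_rw [e]
  have : (0:ℂ) = ∫ t : ℝ, (0:ℂ) ∂ρ := by simp
  rw [this]
  apply tendsto_integral_filter_of_dominated_convergence (fun _ => 1)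
  · refine Eventually.of_forall fun y => Measurable.aestronglyMeasurable ?_
    fun_prop
  · filter_upwards [eventually_ge_atTop 1] with y hy
    refine Eventually.of_forall fun t => ?_
    rw [norm_real, Real.norm_eq_abs, abs_of_nonneg (by positivity)]
    apply div_le_one_of_le₀ <;> nlinarith [sq_nonneg t]
  · exact integrable_const _
  · refine Eventually.of_forall fun t => ?_
    rw [← ofReal_zero]
    apply (Complex.continuous_ofReal.tendsto 0).comp
    apply Tendsto.const_div_atTop
    exact tendsto_atTop_add_const_left _ _ (tendsto_pow_atTop two_ne_zero)

/-- Representation of the permittivity of a general passive medium: if `ω ε(ω)/ε₀` is a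
Herglotz function, `ε` satisfies the reality principle `ε(-conj ω) = conj (ε ω)` and
`ε(iy) → ε₀` as `y → +∞`, then there is a symmetric positive Borel measure `ν_e` on `ℝ`
with `∫ dν_e(ξ)/(1+ξ²) < ∞` such that
`ε(ω) = ε₀ (1 + ∫ dν_e(ξ)/(ξ² - ω²))` for all `ω ∈ ℂ⁺`. -/
theorem passive_permittivity_representation (ε₀ : ℝ) (hε₀ : 0 < ε₀) (ε : ℂ → ℂ)
    (hH : IsHerglotz (fun ω : ℂ => ω * ε ω / (ε₀ : ℂ)))
    (hreal : ∀ ω : ℂ, 0 < ω.im → ε (-(starRingEnd ℂ ω)) = starRingEnd ℂ (ε ω))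
    (hHF : Tendsto (fun y : ℝ => ε (Complex.I * (y : ℂ))) atTop (nhds (ε₀ : ℂ))) :
    ∃ ν : Measure ℝ,
      ν.map (fun x : ℝ => -x) = ν ∧
      Integrable (fun ξ : ℝ => (1 + ξ ^ 2)⁻¹) ν ∧
      ∀ ω : ℂ, 0 < ω.im →
        ε ω = (ε₀ : ℂ) * (1 + ∫ ξ : ℝ, ((ξ : ℂ) ^ 2 - ω ^ 2)⁻¹ ∂ν) := by
  have hε : (ε₀ : ℂ) ≠ 0 := ofReal_ne_zero.2 hε₀.ne'
  obtain ⟨a, ρ, hρ, hrep⟩ := half_plane_rep hH (by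
    intro z hz
    simp only [hreal z hz, map_div₀, map_mul, conj_ofReal]
    ring)
  have hrep' : ∀ z : ℂ, 0 < z.im →
      ε z = ε₀ * (a + ∫ t : ℝ, (1 + (t:ℂ)^2) / ((t:ℂ)^2 - z^2) ∂ρ) := by
    intro z hz
    have h := hrep z hz
    have hz0 : z ≠ 0 := by rintro rfl; simp at hz
    rw [mul_div_assoc] at h
    have := mul_left_cancel₀ hz0 h
    rw [← this]
    field_simp
  have ha : (a : ℂ) = 1 := by
    have h1 : Tendsto (fun y : ℝ => ε (I * (y:ℂ))) atTop (nhds (ε₀ * (a + 0))) := by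
      refine Tendsto.congr' ?_ (((lim_zero ρ).const_add (a:ℂ)).const_mul (ε₀:ℂ))
      filter_upwards [eventually_gt_atTop 0] with y hy
      rw [hrep' (I * y) (by simpa using hy)]
    have h2 := tendsto_nhds_unique h1 hHF
    rw [add_zero] at h2
    exact mul_left_cancel₀ hε (h2.trans (mul_one _).symm)
  let d : ℝ → NNReal := fun t => Real.toNNReal (1 + t^2)
  have hd : Measurable d := by
    apply Measurable.real_toNNReal
    fun_prop
  have hdv : ∀ t, (d t : ℝ) = 1 + t^2 := fun t => Real.coe_toNNReal _ (by positivity)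
  let ν₀ : Measure ℝ := ρ.withDensity (fun t => (d t : ENNReal))
  have hneg : Measurable (fun x : ℝ => -x) := measurable_neg
  have i0 : Integrable (fun ξ : ℝ => (1 + ξ ^ 2)⁻¹) ν₀ := by
    rw [integrable_withDensity_iff_integrable_smul hd]
    refine (integrable_const (1:ℝ)).congr (Eventually.of_forall fun t => ?_)
    simp only [NNReal.smul_def, hdv, smul_eq_mul]
    have : 1 + t^2 ≠ 0 := by positivity
    field_simp
  have hk : ∀ (ω : ℂ) (t : ℝ), d t • ((t:ℂ)^2 - ω^2)⁻¹ = (1 + (t:ℂ)^2) / ((t:ℂ)^2 - ω^2) := by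
    intro ω t
    rw [NNReal.smul_def, hdv, real_smul, div_eq_mul_inv]
    push_cast
    rfl
  have i1 : ∀ ω : ℂ, 0 < ω.im → Integrable (fun ξ : ℝ => ((ξ : ℂ) ^ 2 - ω ^ 2)⁻¹) ν₀ := by
    intro ω hω
    rw [integrable_withDensity_iff_integrable_smul hd]
    simp_rw [hk]
    exact ker_integrable hω ρ
  have v1 : ∀ ω : ℂ, ∫ ξ : ℝ, ((ξ : ℂ) ^ 2 - ω ^ 2)⁻¹ ∂ν₀ =
      ∫ t : ℝ, (1 + (t:ℂ)^2) / ((t:ℂ)^2 - ω^2) ∂ρ := by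
    intro ω
    rw [integral_withDensity_eq_integral_smul hd]
    simp_rw [hk]
  have e : MeasurableEmbedding (fun x : ℝ => -x) := (MeasurableEquiv.neg ℝ).measurableEmbedding
  refine ⟨(2⁻¹ : NNReal) • (ν₀ + ν₀.map (fun x : ℝ => -x)), ?_, ?_, ?_⟩
  · rw [Measure.map_smul, Measure.map_add _ _ hneg, Measure.map_map hneg hneg]
    have : (fun x : ℝ => -x) ∘ (fun x : ℝ => -x) = id := by ext; simp
    rw [this, Measure.map_id, add_comm]
  · apply Integrable.smul_measure_nnreal
    apply i0.add_measure
    rw [e.integrable_map_iff]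
    refine i0.congr (Eventually.of_forall fun t => ?_)
    simp
  · intro ω hω
    have i2 : Integrable (fun ξ : ℝ => ((ξ : ℂ) ^ 2 - ω ^ 2)⁻¹) (ν₀.map (fun x : ℝ => -x)) := by
      rw [e.integrable_map_iff]
      refine (i1 ω hω).congr (Eventually.of_forall fun t => ?_)
      simp
    have v2 : ∫ ξ : ℝ, ((ξ : ℂ) ^ 2 - ω ^ 2)⁻¹ ∂(ν₀.map (fun x : ℝ => -x)) =
        ∫ ξ : ℝ, ((ξ : ℂ) ^ 2 - ω ^ 2)⁻¹ ∂ν₀ := by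
      rw [e.integral_map]
      simp
    rw [integral_smul_nnreal_measure, integral_add_measure (i1 ω hω) i2, v2, v1, hrep' ω hω, ha,
      NNReal.smul_def, real_smul]
    push_cast
    ring
end
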